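/- Properties of the pruned graph. Under assumptions (A1) and (A2), for every ν > 0, with ξ_ν := 3(ν+1)(2−3δ)/((1−δ)(1−2δ)) · log N / log log N, the pruned graph G^p satisfies: (1) with ν-high probability, for all x ∈ [N], D_x − D_x^p ≤ ξ_ν/2; (2) deterministically, G^p contains no down-up paths; (3) deterministically, G^p is a forest (contains no cycles). -/

import Mathlib

open MeasureTheory Real

namespace GRG

variable {N : ℕ}

/-! ### Generic graph-theoretic definitions over an adjacency relation on `Fin N` -/

/-- The degree of a vertex with respect to an adjacency relation. -/
noncomputable def degA (A : Fin N → Fin N → Prop) (x : Fin N) : ℕ :=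
  {y | A x y}.ncard

/-- The strict total order `≺`: `x ≺ y` iff `D_x < D_y`, or `D_x = D_y` and `x > y`. -/
def precA (A : Fin N → Fin N → Prop) (x y : Fin N) : Prop :=
  degA A x < degA A y ∨ (degA A x = degA A y ∧ y < x)

/-- `γ 0, γ 1, …, γ l` is a path for the adjacency relation `A`. -/
def IsPathOn (A : Fin N → Fin N → Prop) (l : ℕ) (γ : ℕ → Fin N) : Prop :=
  ∀ i < l, A (γ i) (γ (i + 1))

/-- A path of length `l` is simple: all vertices distinct except possibly endpoints. -/
def IsSimplePath (l : ℕ) (γ : ℕ → Fin N) : Prop :=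
  ∀ i j, i < j → j ≤ l → ¬(i = 0 ∧ j = l) → γ i ≠ γ j

/-- Two paths are edge-disjoint. -/
def EdgeDisjoint (l l' : ℕ) (γ γ' : ℕ → Fin N) : Prop :=
  ∀ i < l, ∀ j < l',
    ¬((γ i = γ' j ∧ γ (i + 1) = γ' (j + 1)) ∨ (γ i = γ' (j + 1) ∧ γ (i + 1) = γ' j))

/-- `S_1^cyc(x)`: neighbours of `x` that start a simple cycle through `x`
of length at most `2r+1`. -/
def S1cycA (A : Fin N → Fin N → Prop) (r : ℕ) (x : Fin N) : Set (Fin N) :=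
  {y | A x y ∧ ∃ l γ, 3 ≤ l ∧ l ≤ 2 * r + 1 ∧ γ 0 = x ∧ γ 1 = y ∧ γ l = x ∧
    IsPathOn A l γ ∧ IsSimplePath l γ}

/-- `S_1^du(x)`: neighbours `y ∉ S_1^cyc(x)` of `x` that have a neighbour
`z ∉ S_1^cyc(y)` with `y ≺ x ≺ z`. -/
def S1duA (A : Fin N → Fin N → Prop) (r : ℕ) (x : Fin N) : Set (Fin N) :=
  {y | A x y ∧ y ∉ S1cycA A r x ∧ precA A y x ∧
    ∃ z, A y z ∧ z ∉ S1cycA A r y ∧ precA A x z}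

/-- Adjacency in the graph `G^nc` (after removing the cycle-creating edges). -/
def AdjNCA (A : Fin N → Fin N → Prop) (r : ℕ) (x y : Fin N) : Prop :=
  A x y ∧ y ∉ S1cycA A r x ∧ x ∉ S1cycA A r y

/-- Adjacency in the pruned graph `G^p` (after further removing the down-up edges). -/
def AdjPA (A : Fin N → Fin N → Prop) (r : ℕ) (x y : Fin N) : Prop :=
  AdjNCA A r x y ∧ y ∉ S1duA A r x ∧ x ∉ S1duA A r y

/-- Degree in the pruned graph. -/
noncomputable def degPA (A : Fin N → Fin N → Prop) (r : ℕ) (x : Fin N) : ℕ :=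
  {y | AdjPA A r x y}.ncard

/-- `S_1^{p−}(x)`: pruned-graph neighbours of `x` that are smaller than `x` for `≺`. -/
def S1pmA (A : Fin N → Fin N → Prop) (r : ℕ) (x : Fin N) : Set (Fin N) :=
  {y | AdjPA A r x y ∧ precA A y x}

/-- `D_x^{p−}`. -/
noncomputable def degPmA (A : Fin N → Fin N → Prop) (r : ℕ) (x : Fin N) : ℕ :=
  (S1pmA A r x).ncard

/-- `Sib^−(x)`: the smaller siblings of `x` (children of the parent of `x`
that are smaller than `x`). -/
def SibmA (A : Fin N → Fin N → Prop) (r : ℕ) (x : Fin N) : Set (Fin N) :=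
  {y | ∃ p, AdjPA A r x p ∧ precA A x p ∧ AdjPA A r p y ∧ precA A y p ∧ precA A y x}

/-- The normalization constant `Z_x` (note `2/0 = 0` in Lean, so this agrees with the
convention `Z_x = 2` when `Sib^−(x) = ∅`). -/
noncomputable def ZxA (A : Fin N → Fin N → Prop) (r : ℕ) (x : Fin N) : ℝ :=
  2 + 2 / (SibmA A r x).ncard

/-- The indicator vector of a set of vertices. -/
noncomputable def indVec (S : Set (Fin N)) : Fin N → ℝ :=
  S.indicator 1

/-- The approximate eigenvector `u_σ(x)`. -/
noncomputable def uVecA (A : Fin N → Fin N → Prop) (r : ℕ) (σ : ℝ) (x : Fin N) :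
    Fin N → ℝ := fun y =>
  (Real.sqrt (ZxA A r x))⁻¹ *
    (indVec {x} y + σ * (Real.sqrt (degPmA A r x))⁻¹ * indVec (S1pmA A r x) y -
      indVec (SibmA A r x) y / (SibmA A r x).ncard)

/-- The star vector `v_σ(x)`. -/
noncomputable def vVecA (A : Fin N → Fin N → Prop) (r : ℕ) (σ : ℝ) (x : Fin N) :
    Fin N → ℝ := fun y =>
  (Real.sqrt 2)⁻¹ *
    (indVec {x} y + σ * (Real.sqrt (degPmA A r x))⁻¹ * indVec (S1pmA A r x) y)

/-- Euclidean scalar product on `ℝ^N`. -/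
noncomputable def dotR (f g : Fin N → ℝ) : ℝ := ∑ y, f y * g y

/-- The Euclidean (`ℓ² → ℓ²`) operator norm of an `N × N` real matrix. -/
noncomputable def opNorm (M : Matrix (Fin N) (Fin N) ℝ) : ℝ :=
  ‖Matrix.toEuclideanCLM (𝕜 := ℝ) M‖

open Classical in
/-- The adjacency matrix of the pruned graph. -/
noncomputable def adjMatrixPA (A : Fin N → Fin N → Prop) (r : ℕ) :
    Matrix (Fin N) (Fin N) ℝ := fun x y => if AdjPA A r x y then 1 else 0

/-- The threshold `ξ_ν`. -/
noncomputable def xi (ν δ : ℝ) (N : ℕ) : ℝ :=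
  3 * (ν + 1) * (2 - 3 * δ) / ((1 - δ) * (1 - 2 * δ)) *
    (Real.log N / Real.log (Real.log N))

/-- The set `V_ν^{(h)}` of high-degree vertices. -/
def VhA (A : Fin N → Fin N → Prop) (ν δ : ℝ) : Set (Fin N) :=
  {x | xi ν δ N ≤ (degA A x : ℝ)}

/-- The projection `Π^p` onto the span of the vectors `u_σ(x)`, `x ∈ V_ν^{(h)}`. -/
noncomputable def PiPA (A : Fin N → Fin N → Prop) (r : ℕ) (ν δ : ℝ) :
    Matrix (Fin N) (Fin N) ℝ :=
  ∑ x : Fin N, Set.indicator (VhA A ν δ) (fun _ => (1 : ℝ)) x •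
    (Matrix.vecMulVec (uVecA A r 1 x) (uVecA A r 1 x) +
      Matrix.vecMulVec (uVecA A r (-1) x) (uVecA A r (-1) x))

/-- The block-diagonal approximation `Â`. -/
noncomputable def AhatA (A : Fin N → Fin N → Prop) (r : ℕ) (ν δ : ℝ) :
    Matrix (Fin N) (Fin N) ℝ :=
  (∑ x : Fin N, Set.indicator (VhA A ν δ) (fun _ => (1 : ℝ)) x •
    (Real.sqrt (degPmA A r x) •
      (Matrix.vecMulVec (uVecA A r 1 x) (uVecA A r 1 x) -
        Matrix.vecMulVec (uVecA A r (-1) x) (uVecA A r (-1) x)))) +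
  (1 - PiPA A r ν δ) * adjMatrixPA A r * (1 - PiPA A r ν δ)

/-! ### The generalized random graph (GRG) model -/

/-- Index set of potential edges. -/
abbrev EdgeIdx (N : ℕ) := {p : Fin N × Fin N // p.1 < p.2}

/-- The edge probabilities `p_{xy} = w_x w_y / (Σ_z w_z + w_x w_y)`. -/
noncomputable def pGRG (w : Fin N → ℝ) (x y : Fin N) : ℝ :=
  w x * w y / ((∑ z, w z) + w x * w y)

/-- Bernoulli measure with parameter `p` on `Bool`. -/
noncomputable def bern (p : ℝ) : Measure Bool :=
  ENNReal.ofReal p • Measure.dirac true + ENNReal.ofReal (1 - p) • Measure.dirac false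

instance (p : ℝ) : IsFiniteMeasure (bern p) := by
  constructor
  simp only [bern, Measure.coe_add, Measure.coe_smul, Pi.add_apply, Pi.smul_apply,
    smul_eq_mul, measure_univ, mul_one]
  exact ENNReal.add_lt_top.mpr ⟨ENNReal.ofReal_lt_top, ENNReal.ofReal_lt_top⟩

/-- The law of the GRG: independent Bernoulli edge indicators. -/
noncomputable def grgMeasure (w : Fin N → ℝ) : Measure (EdgeIdx N → Bool) :=
  Measure.pi fun e => bern (pGRG w e.val.1 e.val.2)

/-- The (random) adjacency matrix. -/
noncomputable def adjMatrix (ω : EdgeIdx N → Bool) : Matrix (Fin N) (Fin N) ℝ :=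
  fun x y =>
    if h : x < y then (if ω ⟨(x, y), h⟩ then 1 else 0)
    else if h' : y < x then (if ω ⟨(y, x), h'⟩ then 1 else 0)
    else 0

/-- The (random) adjacency relation. -/
def Adj (ω : EdgeIdx N → Bool) (x y : Fin N) : Prop := adjMatrix ω x y = 1

/-- The (random) degree `D_x`. -/
noncomputable def deg (ω : EdgeIdx N → Bool) (x : Fin N) : ℕ := degA (Adj ω) x

/-- The first empirical moment `m_1`. -/
noncomputable def m1 (w : Fin N → ℝ) : ℝ := (∑ x, w x) / N

/-- The second empirical moment `m_2`. -/
noncomputable def m2 (w : Fin N → ℝ) : ℝ := (∑ x, w x ^ 2) / N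

/-- The expected degree `d_x = E[D_x]`. -/
noncomputable def dExp (w : Fin N → ℝ) (x : Fin N) : ℝ :=
  ∫ ω, (deg ω x : ℝ) ∂(grgMeasure w)

/-- The set `W_{λ,η}` of resonant vertices. -/
def resonant (ω : EdgeIdx N → Bool) (lam η : ℝ) : Set (Fin N) :=
  {x | |Real.sqrt (deg ω x) - lam| ≤ η}

/-- The set `V*_{ν,η}` of isolated vertices. -/
noncomputable def Vstar (w : Fin N → ℝ) (ν η : ℝ) : Set (Fin N) :=
  {x | (4 * ν / 9) * Real.log N ≤ dExp w x ∧
    ∀ y, y ≠ x →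
      max (4 * Real.sqrt (ν * Real.log N * dExp w x) +
            4 * Real.sqrt (ν * Real.log N * dExp w y))
          (16 * η ^ 2) ≤ |dExp w x - dExp w y|}

end GRG


namespace GRG

theorem Adj_symm {N : ℕ} (ω : EdgeIdx N → Bool) {x y : Fin N} (h : Adj ω x y) : Adj ω y x := by
  unfold Adj adjMatrix at *
  rcases lt_trichotomy x y with h1 | h1 | h1
  · simp only [h1, not_lt_of_gt h1, dite_true, dite_false] at *
    exact h
  · subst h1; simp at h
  · simp only [h1, not_lt_of_gt h1, dite_true, dite_false] at *
    exact h

theorem Adj_irrefl {N : ℕ} (ω : EdgeIdx N → Bool) (x : Fin N) : ¬ Adj ω x x := by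
  unfold Adj adjMatrix
  simp

theorem precA_trans {N : ℕ} {A : Fin N → Fin N → Prop} {x y z : Fin N}
    (h1 : precA A x y) (h2 : precA A y z) : precA A x z := by
  unfold precA at *
  rcases h1 with h1 | ⟨h1, h1'⟩ <;> rcases h2 with h2 | ⟨h2, h2'⟩
  · left; omega
  · left; omega
  · left; omega
  · right; exact ⟨by omega, h2'.trans h1'⟩

theorem precA_irrefl {N : ℕ} {A : Fin N → Fin N → Prop} (x : Fin N) : ¬ precA A x x := by
  unfold precA
  simp

theorem precA_total {N : ℕ} {A : Fin N → Fin N → Prop} {x y : Fin N} (h : x ≠ y) :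
    precA A x y ∨ precA A y x := by
  unfold precA
  rcases lt_trichotomy (degA A x) (degA A y) with h1 | h1 | h1
  · left; left; exact h1
  · rcases lt_or_gt_of_ne h with h2 | h2
    · right; right; exact ⟨h1.symm, h2⟩
    · left; right; exact ⟨h1, h2⟩
  · right; left; exact h1

theorem precA_deg {N : ℕ} {A : Fin N → Fin N → Prop} {x y : Fin N} (h : precA A x y) :
    degA A x ≤ degA A y := by
  rcases h with h | h
  · exact h.le
  · exact h.1.le

theorem no_down_up (r N : ℕ) (ω : EdgeIdx N → Bool) :
      ¬∃ x y z : Fin N, AdjPA (Adj ω) r x y ∧ AdjPA (Adj ω) r y z ∧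
        precA (Adj ω) y x ∧ precA (Adj ω) x z := by
  rintro ⟨x, y, z, hxy, hyz, h1, h2⟩
  exact hxy.2.1 ⟨hxy.1.1, hxy.1.2.1, h1, z, hyz.1.1, hyz.1.2.1, h2⟩

theorem AdjPA_symm {N : ℕ} {ω : EdgeIdx N → Bool} {r : ℕ} {x y : Fin N}
    (h : AdjPA (Adj ω) r x y) : AdjPA (Adj ω) r y x :=
  ⟨⟨Adj_symm ω h.1.1, h.1.2.2, h.1.2.1⟩, h.2.2, h.2.1⟩

/-- A minimal index along a path for `≺`. -/
theorem exists_min_idx {N : ℕ} (A : Fin N → Fin N → Prop) (γ : ℕ → Fin N) (l : ℕ) (hl : 0 < l) :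
    ∃ i < l, ∀ j < l, γ j ≠ γ i → precA A (γ i) (γ j) := by
  induction l with
  | zero => omega
  | succ n ih =>
    rcases Nat.eq_zero_or_pos n with hn | hn
    · subst hn
      refine ⟨0, by omega, fun j hj hne => ?_⟩
      have : j = 0 := by omega
      subst this; exact absurd rfl hne
    · obtain ⟨i, hi, him⟩ := ih hn
      by_cases hlt : precA A (γ n) (γ i)
      · refine ⟨n, by omega, fun j hj hne => ?_⟩
        rcases Nat.lt_succ_iff_lt_or_eq.mp hj with h | h
        · by_cases hji : γ j = γ i
          · rw [hji]; exact hlt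
          · exact precA_trans hlt (him j h hji)
        · subst h; exact absurd rfl hne
      · refine ⟨i, by omega, fun j hj hne => ?_⟩
        rcases Nat.lt_succ_iff_lt_or_eq.mp hj with h | h
        · exact him j h hne
        · subst h
          rcases precA_total (A := A) hne with h | h
          · exact absurd h hlt
          · exact h

theorem is_forest (r N : ℕ) (ω : EdgeIdx N → Bool) :
      ¬∃ (l : ℕ) (γ : ℕ → Fin N), 3 ≤ l ∧ γ 0 = γ l ∧
        IsPathOn (AdjPA (Adj ω) r) l γ ∧ IsSimplePath l γ := by
  rintro ⟨l, γ, hl, hcl, hp, hs⟩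
  -- a vertex with two distinct larger neighbours
  have key : ∀ x y z : Fin N, AdjPA (Adj ω) r x y → AdjPA (Adj ω) r y z → x ≠ z →
      precA (Adj ω) y x → precA (Adj ω) y z → False := by
    intro x y z hxy hyz hne h1 h2
    rcases precA_total (A := Adj ω) hne with h | h
    · exact no_down_up r N ω ⟨x, y, z, hxy, hyz, h1, h⟩
    · exact no_down_up r N ω ⟨z, y, x, AdjPA_symm hyz, AdjPA_symm hxy, h2, h⟩
  obtain ⟨i, hi, him⟩ := exists_min_idx (Adj ω) γ l (by omega)
  rcases Nat.eq_zero_or_pos i with h0 | h0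
  · subst h0
    have e1 := hp (l - 1) (by omega)
    have e2 := hp 0 (by omega)
    rw [show l - 1 + 1 = l by omega, ← hcl] at e1
    refine key _ _ _ e1 e2 ?_ ?_ ?_
    · exact (hs (0 + 1) (l - 1) (by omega) (by omega) (by omega)).symm
    · exact him _ (by omega) (hs 0 (l - 1) (by omega) (by omega) (by omega)).symm
    · exact him _ (by omega) (hs 0 (0 + 1) (by omega) (by omega) (by omega)).symm
  · have e1 := hp (i - 1) (by omega)
    have e2 := hp i (by omega)
    rw [show i - 1 + 1 = i by omega] at e1
    refine key _ _ _ e1 e2 ?_ ?_ ?_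
    · exact (hs (i - 1) (i + 1) (by omega) (by omega) (by omega))
    · exact him _ (by omega) (hs (i - 1) i (by omega) (by omega) (by omega))
    · by_cases h : i + 1 = l
      · rw [h, ← hcl]
        exact him _ (by omega) (hs 0 i (by omega) (by omega) (by omega))
      · exact him _ (by omega) (hs i (i + 1) (by omega) (by omega) (by omega)).symm

end GRG

namespace GRG
open Finset

/-- The (at most one element) set of edge indices joining `x` and `y`. -/
def ed {N : ℕ} (x y : Fin N) : Finset (EdgeIdx N) :=
  Finset.univ.filter (fun e => (e.1.1 = x ∧ e.1.2 = y) ∨ (e.1.1 = y ∧ e.1.2 = x))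

theorem mem_ed {N : ℕ} {x y : Fin N} {e : EdgeIdx N} :
    e ∈ ed x y ↔ (e.1.1 = x ∧ e.1.2 = y) ∨ (e.1.1 = y ∧ e.1.2 = x) := by
  simp [ed]

theorem ed_of_lt {N : ℕ} {x y : Fin N} (h : x < y) : ed x y = {⟨(x, y), h⟩} := by
  ext e
  rw [mem_ed, Finset.mem_singleton]
  constructor
  · rintro (⟨h1, h2⟩ | ⟨h1, h2⟩)
    · apply Subtype.ext; exact Prod.ext h1 h2
    · exfalso
      have := e.2
      rw [h1, h2] at this
      exact lt_asymm h this
  · rintro rfl; left; exact ⟨rfl, rfl⟩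

theorem ed_comm {N : ℕ} (x y : Fin N) : ed x y = ed y x := by
  ext e; rw [mem_ed, mem_ed]; tauto

/-- A common edge gives a common pair of endpoints. -/
theorem ed_inter {N : ℕ} {x y x' y' : Fin N} {e : EdgeIdx N} (h : e ∈ ed x y)
    (h' : e ∈ ed x' y') : (x = x' ∧ y = y') ∨ (x = y' ∧ y = x') := by
  rw [mem_ed] at h h'
  rcases h with ⟨h1, h2⟩ | ⟨h1, h2⟩ <;> rcases h' with ⟨h3, h4⟩ | ⟨h3, h4⟩ <;>
    simp [← h1, ← h2, ← h3, ← h4]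

theorem Adj_iff {N : ℕ} (ω : EdgeIdx N → Bool) (x y : Fin N) :
    Adj ω x y ↔ x ≠ y ∧ ∀ e ∈ ed x y, ω e = true := by
  unfold Adj adjMatrix
  rcases lt_trichotomy x y with h1 | h1 | h1
  · rw [ed_of_lt h1]
    simp [h1, h1.ne]
  · subst h1; simp
  · rw [ed_comm, ed_of_lt h1]
    simp [h1, h1.ne', not_lt_of_gt h1]

/-- Edge probability. -/
noncomputable def pe {N : ℕ} (w : Fin N → ℝ) (e : EdgeIdx N) : ℝ := pGRG w e.1.1 e.1.2

theorem pGRG_nonneg {N : ℕ} {w : Fin N → ℝ} (hw : ∀ x, 0 < w x) (x y : Fin N) :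
    0 ≤ pGRG w x y := by
  unfold pGRG
  have := Finset.sum_nonneg (fun z (_ : z ∈ Finset.univ) => (hw z).le)
  have := mul_pos (hw x) (hw y)
  positivity

theorem pGRG_le_one {N : ℕ} {w : Fin N → ℝ} (hw : ∀ x, 0 < w x) (x y : Fin N) :
    pGRG w x y ≤ 1 := by
  unfold pGRG
  have := Finset.sum_nonneg (fun z (_ : z ∈ Finset.univ) => (hw z).le)
  have := mul_pos (hw x) (hw y)
  rw [div_le_one (by positivity)]
  linarith

theorem sum_w_pos {N : ℕ} {w : Fin N → ℝ} (hw : ∀ x, 0 < w x) (x : Fin N) :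
    0 < ∑ z, w z :=
  Finset.sum_pos (fun z _ => hw z) ⟨x, Finset.mem_univ x⟩

theorem pGRG_le {N : ℕ} {w : Fin N → ℝ} (hw : ∀ x, 0 < w x) (x y : Fin N) :
    pGRG w x y ≤ w x * w y / ∑ z, w z := by
  unfold pGRG
  have := sum_w_pos hw x
  have := mul_pos (hw x) (hw y)
  gcongr
  linarith

theorem pGRG_comm {N : ℕ} (w : Fin N → ℝ) (x y : Fin N) : pGRG w x y = pGRG w y x := by
  unfold pGRG; rw [mul_comm (w x)]

theorem prod_ed {N : ℕ} (w : Fin N → ℝ) {x y : Fin N} (h : x ≠ y) :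
    ∏ e ∈ ed x y, pe w e = pGRG w x y := by
  rcases lt_or_gt_of_ne h with h | h
  · rw [ed_of_lt h]; simp [pe]
  · rw [ed_comm, ed_of_lt h]; simp [pe, pGRG_comm]

theorem pe_nonneg {N : ℕ} {w : Fin N → ℝ} (hw : ∀ x, 0 < w x) (e : EdgeIdx N) : 0 ≤ pe w e :=
  pGRG_nonneg hw _ _

theorem pe_le_one {N : ℕ} {w : Fin N → ℝ} (hw : ∀ x, 0 < w x) (e : EdgeIdx N) : pe w e ≤ 1 :=
  pGRG_le_one hw _ _

theorem bern_prob {p : ℝ} (h0 : 0 ≤ p) (h1 : p ≤ 1) : IsProbabilityMeasure (bern p) := by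
  constructor
  simp only [bern, Measure.coe_add, Measure.coe_smul, Pi.add_apply, Pi.smul_apply,
    smul_eq_mul, measure_univ, mul_one]
  rw [← ENNReal.ofReal_add h0 (by linarith)]
  simp

theorem grg_prob {N : ℕ} {w : Fin N → ℝ} (hw : ∀ x, 0 < w x) :
    IsProbabilityMeasure (grgMeasure w) := by
  have : ∀ e : EdgeIdx N, IsProbabilityMeasure (bern (pGRG w e.val.1 e.val.2)) :=
    fun e => bern_prob (pe_nonneg hw e) (pe_le_one hw e)
  unfold grgMeasure
  infer_instance

theorem bern_true (p : ℝ) : bern p {true} = ENNReal.ofReal p := by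
  simp [bern]

/-- Probability that all edges in `F` are present. -/
theorem prob_present {N : ℕ} {w : Fin N → ℝ} (hw : ∀ x, 0 < w x) (F : Finset (EdgeIdx N)) :
    (grgMeasure w).real {ω | ∀ e ∈ F, ω e = true} = ∏ e ∈ F, pe w e := by
  classical
  have : ∀ e : EdgeIdx N, IsProbabilityMeasure (bern (pGRG w e.val.1 e.val.2)) :=
    fun e => bern_prob (pe_nonneg hw e) (pe_le_one hw e)
  have hset : {ω : EdgeIdx N → Bool | ∀ e ∈ F, ω e = true} =
      Set.pi Set.univ (fun e => if e ∈ F then {true} else Set.univ) := by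
    ext ω
    simp only [Set.mem_ofPred_eq, Set.mem_pi, Set.mem_univ, true_implies]
    refine forall_congr' fun e => ?_
    by_cases h : e ∈ F <;> simp [h]
  rw [Measure.real, hset, grgMeasure, Measure.pi_pi, ENNReal.toReal_prod]
  have : ∀ e : EdgeIdx N, ((bern (pGRG w e.val.1 e.val.2))
      (if e ∈ F then {true} else Set.univ)).toReal = if e ∈ F then pe w e else 1 := by
    intro e
    by_cases h : e ∈ F
    · simp only [h, if_true, bern_true]
      exact ENNReal.toReal_ofReal (pe_nonneg hw e)
    · simp only [h, if_false, measure_univ, ENNReal.toReal_one]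
  simp_rw [this]
  rw [Finset.prod_ite_mem, Finset.univ_inter]

theorem pow_aux (S q : ℝ) (hS : 0 ≤ S) (hq : 0 ≤ q) (k : ℕ) :
    S ^ (k + 1) + (k + 1) * (q * S ^ k) ≤ (q + S) ^ (k + 1) := by
  induction k with
  | zero => simp; linarith
  | succ k ih =>
    have h1 := mul_le_mul_of_nonneg_right ih (add_nonneg hq hS)
    rw [pow_succ (q + S)]
    refine le_trans ?_ h1
    push_cast
    have h2 : 0 ≤ (k + 1) * (q * S ^ k) * q := by positivity
    have h3 : S ^ (k + 1 + 1) = S ^ k * S * S := by ring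
    rw [h3, pow_succ S k]
    nlinarith

theorem esymm_le {ι : Type*} [DecidableEq ι] (q : ι → ℝ) (hq : ∀ i, 0 ≤ q i) (I : Finset ι) :
    ∀ k : ℕ, ∑ s ∈ I.powersetCard k, ∏ i ∈ s, q i ≤ (∑ i ∈ I, q i) ^ k / k.factorial := by
  induction I using Finset.induction_on with
  | empty =>
    intro k
    cases k with
    | zero => simp
    | succ k =>
      rw [Finset.powersetCard_eq_empty.mpr (by simp)]
      simp
  | insert a I ha ih =>
    intro k
    cases k with
    | zero => simp
    | succ k =>
      have hS : 0 ≤ ∑ i ∈ I, q i := Finset.sum_nonneg fun i _ => hq i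
      rw [Finset.powersetCard_succ_insert ha, Finset.sum_union, Finset.sum_image,
        Finset.sum_insert ha]
      · have h1 := ih (k + 1)
        have h2 : ∑ s ∈ I.powersetCard k, ∏ i ∈ insert a s, q i =
            q a * ∑ s ∈ I.powersetCard k, ∏ i ∈ s, q i := by
          rw [Finset.mul_sum]
          refine Finset.sum_congr rfl fun s hs => ?_
          rw [Finset.prod_insert]
          exact fun h => ha ((Finset.mem_powersetCard.mp hs).1 h)
        rw [h2]
        have h3 := mul_le_mul_of_nonneg_left (ih k) (hq a)
        have h4 : (∑ i ∈ I, q i) ^ (k + 1) + (k + 1) * (q a * (∑ i ∈ I, q i) ^ k) ≤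
            (q a + ∑ i ∈ I, q i) ^ (k + 1) := by
          exact pow_aux _ _ hS (hq a) k
        refine (add_le_add h1 h3).trans ?_
        have hk : ((k + 1).factorial : ℝ) = (k + 1) * k.factorial := by
          push_cast [Nat.factorial_succ]; ring
        have hkp : (0 : ℝ) < k.factorial := by positivity
        rw [hk, le_div_iff₀ (by positivity)]
        calc _ = (∑ i ∈ I, q i) ^ (k + 1) + (k + 1) * (q a * (∑ i ∈ I, q i) ^ k) := by
              field_simp
          _ ≤ _ := h4
      · intro s hs t ht hst
        have hs' : a ∉ s := fun h => ha ((Finset.mem_powersetCard.mp hs).1 h)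
        have ht' : a ∉ t := fun h => ha ((Finset.mem_powersetCard.mp ht).1 h)
        rw [← Finset.erase_insert hs', ← Finset.erase_insert ht', hst]
      · rw [Finset.disjoint_left]
        intro s hs hs'
        obtain ⟨t, _, rfl⟩ := Finset.mem_image.mp hs'
        exact ha ((Finset.mem_powersetCard.mp hs).1 (Finset.mem_insert_self a t))

/-- Disjoint occurrences of edge sets: the event. -/
def disjEvent {N : ℕ} {ι : Type*} (I : Finset ι) (F : ι → Finset (EdgeIdx N)) (k : ℕ) :
    Set (EdgeIdx N → Bool) :=
  {ω | ∃ s ⊆ I, s.card = k ∧ (s : Set ι).PairwiseDisjoint F ∧ ∀ i ∈ s, ∀ e ∈ F i, ω e = true}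

theorem prob_disjEvent {N : ℕ} {w : Fin N → ℝ} (hw : ∀ x, 0 < w x) {ι : Type*}
    (I : Finset ι) (F : ι → Finset (EdgeIdx N)) (k : ℕ) (b : ℝ)
    (hb : ∑ i ∈ I, ∏ e ∈ F i, pe w e ≤ b) :
    (grgMeasure w).real (disjEvent I F k) ≤ b ^ k / k.factorial := by
  classical
  have := grg_prob hw
  have hq : ∀ i, 0 ≤ ∏ e ∈ F i, pe w e := fun i => Finset.prod_nonneg fun e _ => pe_nonneg hw e
  have hsub : disjEvent I F k ⊆ ⋃ s ∈ (I.powersetCard k).filter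
      (fun s : Finset ι => (s : Set ι).PairwiseDisjoint F), {ω | ∀ e ∈ s.biUnion F, ω e = true} := by
    rintro ω ⟨s, hsI, hsk, hd, hp⟩
    simp only [Set.mem_iUnion]
    refine ⟨s, Finset.mem_filter.mpr ⟨Finset.mem_powersetCard.mpr ⟨hsI, hsk⟩, hd⟩, ?_⟩
    intro e he
    obtain ⟨i, hi, hei⟩ := Finset.mem_biUnion.mp he
    exact hp i hi e hei
  calc (grgMeasure w).real (disjEvent I F k)
      ≤ _ := measureReal_mono hsub (measure_ne_top _ _)
    _ ≤ _ := measureReal_biUnion_finset_le _ _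
    _ = ∑ s ∈ (I.powersetCard k).filter (fun s : Finset ι => (s : Set ι).PairwiseDisjoint F),
          ∏ i ∈ s, ∏ e ∈ F i, pe w e := by
        refine Finset.sum_congr rfl fun s hs => ?_
        rw [prob_present hw, Finset.prod_biUnion (Finset.mem_filter.mp hs).2]
    _ ≤ ∑ s ∈ I.powersetCard k, ∏ i ∈ s, ∏ e ∈ F i, pe w e := by
        refine Finset.sum_le_sum_of_subset_of_nonneg (Finset.filter_subset _ _) ?_
        intro s _ _
        exact Finset.prod_nonneg fun i _ => hq i
    _ ≤ (∑ i ∈ I, ∏ e ∈ F i, pe w e) ^ k / k.factorial := esymm_le _ hq I k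
    _ ≤ _ := by
        have : 0 ≤ ∑ i ∈ I, ∏ e ∈ F i, pe w e := Finset.sum_nonneg fun i _ => hq i
        gcongr

end GRG

namespace GRG
open Finset

/-- Combinatorial part of being a simple path (or cycle of length at least 3) from `x` to `h`. -/
def GoodC {N : ℕ} (x h : Fin N) (l : ℕ) (γ : ℕ → Fin N) : Prop :=
  1 ≤ l ∧ γ 0 = x ∧ γ l = h ∧ IsSimplePath l γ ∧ (x = h → 3 ≤ l)

/-- Edges of a path. -/
def edg {N : ℕ} (l : ℕ) (γ : ℕ → Fin N) : Finset (EdgeIdx N) :=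
  (Finset.range l).biUnion fun i => ed (γ i) (γ (i + 1))

/-- The path from `x` to `h` with prescribed internal vertices. -/
def pathOf {N : ℕ} (x h : Fin N) (n : ℕ) (u : Fin n → Fin N) : ℕ → Fin N :=
  fun i => if i = 0 then x else if hi : i - 1 < n then u ⟨i - 1, hi⟩ else h

theorem edg_congr {N : ℕ} {l : ℕ} {γ γ' : ℕ → Fin N} (h : ∀ t ≤ l, γ t = γ' t) :
    edg l γ = edg l γ' := by
  unfold edg
  refine Finset.biUnion_congr rfl fun i hi => ?_
  have := Finset.mem_range.mp hi
  rw [h i (by omega), h (i + 1) (by omega)]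

theorem GoodC_congr {N : ℕ} {x h : Fin N} {l : ℕ} {γ γ' : ℕ → Fin N}
    (hh : ∀ t ≤ l, γ t = γ' t) (hg : GoodC x h l γ) : GoodC x h l γ' := by
  obtain ⟨h1, h2, h3, h4, h5⟩ := hg
  refine ⟨h1, ?_, ?_, ?_, h5⟩
  · rw [← hh 0 (by omega), h2]
  · rw [← hh l le_rfl, h3]
  · intro i j hij hjl hne
    rw [← hh i (by omega), ← hh j hjl]
    exact h4 i j hij hjl hne

theorem pathOf_eq {N : ℕ} {x h : Fin N} {n : ℕ} {γ : ℕ → Fin N} (h0 : γ 0 = x)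
    (h1 : γ (n + 1) = h) :
    ∀ t ≤ n + 1, γ t = pathOf x h n (fun j => γ (j + 1)) t := by
  intro t ht
  unfold pathOf
  by_cases h : t = 0
  · simp [h, h0]
  · by_cases h' : t - 1 < n
    · simp only [h, h', if_false, dite_true]
      congr 1; omega
    · simp only [h, h', if_false, dite_false]
      rw [← h1]; congr 1; omega

/-- Distinctness of consecutive vertices. -/
theorem GoodC_ne {N : ℕ} {x h : Fin N} {l : ℕ} {γ : ℕ → Fin N} (hg : GoodC x h l γ)
    {i : ℕ} (hi : i < l) : γ i ≠ γ (i + 1) := by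
  obtain ⟨h1, h2, h3, h4, h5⟩ := hg
  by_cases hc : i = 0 ∧ i + 1 = l
  · obtain ⟨rfl, rfl⟩ := hc
    rw [h2, h3]
    intro he
    have := h5 he
    omega
  · exact h4 i (i + 1) (by omega) (by omega) hc

theorem GoodC_disj {N : ℕ} {x h : Fin N} {l : ℕ} {γ : ℕ → Fin N} (hg : GoodC x h l γ) :
    ((Finset.range l : Finset ℕ) : Set ℕ).PairwiseDisjoint (fun i => ed (γ i) (γ (i + 1))) := by
  obtain ⟨h1, h2, h3, h4, h5⟩ := hg
  have main : ∀ i j, i < j → j < l → Disjoint (ed (γ i) (γ (i + 1))) (ed (γ j) (γ (j + 1))) := by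
    intro i j hij hj
    rw [Finset.disjoint_left]
    intro e he he'
    rcases ed_inter he he' with ⟨ha, hb⟩ | ⟨ha, hb⟩
    · exact h4 i j hij (by omega) (by omega) ha
    · by_cases hc : i = 0 ∧ j + 1 = l
      · obtain ⟨rfl, rfl⟩ := hc
        have := h5 (by rw [← h2, ← h3, ha])
        exact h4 (0 + 1) j (by omega) (by omega) (by omega) hb
      · exact h4 i (j + 1) (by omega) (by omega) hc ha
  intro i hi j hj hij
  have hi' : i < l := by simpa using hi
  have hj' : j < l := by simpa using hj
  rcases lt_or_gt_of_ne hij with h | h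
  · exact main i j h hj'
  · exact (main j i h hi').symm

/-- Index set for paths of length at most `R`. -/
abbrev PIdx (N R : ℕ) := Σ n : Fin R, (Fin n → Fin N)

def Fp {N R : ℕ} (x h : Fin N) (i : PIdx N R) : Finset (EdgeIdx N) :=
  edg (i.1 + 1) (pathOf x h i.1 i.2)

open Classical in
noncomputable def Ip {N : ℕ} (R : ℕ) (x h : Fin N) : Finset (PIdx N R) :=
  Finset.univ.filter (fun i => GoodC x h (i.1 + 1) (pathOf x h i.1 i.2))

theorem exists_index {N R : ℕ} {x h : Fin N} {l : ℕ} {γ : ℕ → Fin N} (hg : GoodC x h l γ)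
    (hl : l ≤ R) : ∃ i ∈ Ip R x h, (i.1 : ℕ) + 1 = l ∧ ∀ t ≤ l, γ t = pathOf x h i.1 i.2 t := by
  obtain ⟨n, rfl⟩ : ∃ n, l = n + 1 := ⟨l - 1, by have := hg.1; omega⟩
  have heq := pathOf_eq hg.2.1 hg.2.2.1
  refine ⟨⟨⟨n, by omega⟩, fun j => γ (j + 1)⟩, ?_, rfl, heq⟩
  simp only [Ip, Finset.mem_filter, Finset.mem_univ, true_and]
  exact GoodC_congr heq hg

theorem prod_path {N : ℕ} (w : Fin N → ℝ) (S : ℝ) (x h : Fin N) (n : ℕ) (u : Fin n → Fin N) :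
    ∏ i ∈ Finset.range (n + 1), (w (pathOf x h n u i) * w (pathOf x h n u (i + 1)) / S) =
      (w x * w h / S) * ∏ j, (w (u j) ^ 2 / S) := by
  have e0 : pathOf x h n u 0 = x := by simp [pathOf]
  have e1 : pathOf x h n u (n + 1) = h := by simp [pathOf]
  have e2 : ∏ i ∈ Finset.range n, w (pathOf x h n u (i + 1)) = ∏ j, w (u j) := by
    rw [← Fin.prod_univ_eq_prod_range (fun i => w (pathOf x h n u (i + 1)))]
    refine Finset.prod_congr rfl fun j _ => ?_
    simp [pathOf]
  rw [Finset.prod_div_distrib, Finset.prod_mul_distrib, Finset.prod_div_distrib,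
    Finset.prod_range_succ' (fun i => w (pathOf x h n u i)),
    Finset.prod_range_succ (fun i => w (pathOf x h n u (i + 1))), e0, e1, e2,
    Finset.prod_pow]
  simp only [Finset.prod_const, Finset.card_range, Finset.card_univ, Fintype.card_fin]
  rw [div_mul_div_comm, ← pow_succ']
  ring

theorem prod_Fp_le {N R : ℕ} {w : Fin N → ℝ} (hw : ∀ x, 0 < w x) (x h : Fin N)
    (i : PIdx N R) (hi : i ∈ Ip R x h) :
    ∏ e ∈ Fp x h i, pe w e ≤
      (w x * w h / ∑ z, w z) * ∏ j, (w (i.2 j) ^ 2 / ∑ z, w z) := by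
  have hg : GoodC x h (i.1 + 1) (pathOf x h i.1 i.2) := by
    simpa [Ip] using hi
  rw [← prod_path, Fp, edg, Finset.prod_biUnion (GoodC_disj hg)]
  refine Finset.prod_le_prod (fun t _ => Finset.prod_nonneg fun e _ => pe_nonneg hw e) ?_
  intro t ht
  rw [prod_ed w (GoodC_ne hg (Finset.mem_range.mp ht))]
  exact pGRG_le hw _ _

theorem sum_Fp_le {N R : ℕ} {w : Fin N → ℝ} (hw : ∀ x, 0 < w x) (x h : Fin N) (Λ : ℝ)
    (hΛ1 : 1 ≤ Λ) (hΛ : (∑ z, w z ^ 2) / (∑ z, w z) ≤ Λ) :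
    ∑ i ∈ Ip R x h, ∏ e ∈ Fp x h i, pe w e ≤ R * ((w x * w h / ∑ z, w z) * Λ ^ R) := by
  have hS := sum_w_pos hw x
  have hc : 0 ≤ w x * w h / ∑ z, w z := by
    have := hw x; have := hw h; positivity
  calc ∑ i ∈ Ip R x h, ∏ e ∈ Fp x h i, pe w e
      ≤ ∑ i ∈ Ip R x h, (w x * w h / ∑ z, w z) * ∏ j, (w (i.2 j) ^ 2 / ∑ z, w z) :=
        Finset.sum_le_sum fun i hi => prod_Fp_le hw x h i hi
    _ ≤ ∑ i : PIdx N R, (w x * w h / ∑ z, w z) * ∏ j, (w (i.2 j) ^ 2 / ∑ z, w z) := by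
        refine Finset.sum_le_sum_of_subset_of_nonneg (Finset.subset_univ _) ?_
        intro i _ _
        exact mul_nonneg hc (Finset.prod_nonneg fun j _ => by positivity)
    _ = ∑ n : Fin R, (w x * w h / ∑ z, w z) * ((∑ z, w z ^ 2) / (∑ z, w z)) ^ (n : ℕ) := by
        rw [Fintype.sum_sigma]
        refine Finset.sum_congr rfl fun n _ => ?_
        rw [← Finset.mul_sum, Finset.sum_div]
        congr 1
        exact (Fintype.sum_pow (fun z => w z ^ 2 / ∑ z, w z) (n : ℕ)).symm
    _ ≤ ∑ n : Fin R, (w x * w h / ∑ z, w z) * Λ ^ R := by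
        refine Finset.sum_le_sum fun n _ => ?_
        refine mul_le_mul_of_nonneg_left ?_ hc
        calc ((∑ z, w z ^ 2) / (∑ z, w z)) ^ (n : ℕ) ≤ Λ ^ (n : ℕ) := by
              gcongr
          _ ≤ Λ ^ R := pow_le_pow_right₀ hΛ1 n.2.le
    _ = _ := by simp

theorem exists_max_disj {ι E : Type*} [DecidableEq ι] [DecidableEq E] (P : Finset ι) (F : ι → Finset E)
    (hne : ∀ i ∈ P, (F i).Nonempty) :
    ∃ s ⊆ P, (s : Set ι).PairwiseDisjoint F ∧ ∀ i ∈ P, ∃ j ∈ s, ¬ Disjoint (F i) (F j) := by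
  classical
  obtain ⟨s, hs, hmax⟩ := Finset.exists_max_image
    (P.powerset.filter fun s : Finset ι => (s : Set ι).PairwiseDisjoint F) Finset.card
    ⟨∅, by simp⟩
  simp only [Finset.mem_filter, Finset.mem_powerset] at hs hmax
  refine ⟨s, hs.1, hs.2, fun i hi => ?_⟩
  by_contra hcon
  push Not at hcon
  have his : i ∉ s := fun h => by
    have := hcon i h
    rw [disjoint_self] at this
    exact (hne i hi).ne_empty this
  have := hmax (insert i s) ⟨Finset.insert_subset hi hs.1, by
    rw [Finset.coe_insert]
    exact hs.2.insert fun j hj _ => hcon j hj⟩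
  rw [Finset.card_insert_of_notMem his] at this
  omega

/-- The recursive bound. -/
def Mrec (m R : ℕ) : ℕ → ℕ
  | 0 => 0
  | j + 1 => m * (R + 1) * (1 + Mrec m R j)

/-- First vertices of paths from `x` to `h` of length at most `j`. -/
def Yset {N : ℕ} (ω : EdgeIdx N → Bool) (j : ℕ) (x h : Fin N) : Set (Fin N) :=
  {y | ∃ l γ, l ≤ j ∧ GoodC x h l γ ∧ IsPathOn (Adj ω) l γ ∧ γ 1 = y}

theorem Yset_card {N : ℕ} (ω : EdgeIdx N → Bool) (m R : ℕ)
    (hω : ∀ x h : Fin N, ω ∉ disjEvent (Ip R x h) (Fp x h) m) :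
    ∀ j ≤ R, ∀ x h : Fin N, (Yset ω j x h).ncard ≤ Mrec m R j := by
  classical
  intro j
  induction j with
  | zero =>
    intro _ x h
    have : Yset ω 0 x h = ∅ := by
      ext y
      simp only [Yset, Set.mem_ofPred_eq, Set.mem_empty_iff_false, iff_false]
      rintro ⟨l, γ, hl, hg, _⟩
      have := hg.1
      omega
    rw [this]; simp
  | succ j ih =>
    intro hj x h
    have ih' := ih (by omega)
    set P : Finset (PIdx N R) := (Ip R x h).filter (fun i => ∀ e ∈ Fp x h i, ω e = true) with hP
    have hne : ∀ i ∈ P, (Fp x h i).Nonempty := by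
      intro i hi
      have hg : GoodC x h (i.1 + 1) (pathOf x h i.1 i.2) := by
        have := (Finset.mem_filter.mp hi).1
        simpa [Ip] using this
      have h01 := GoodC_ne hg (i := 0) (by omega)
      have : (ed (pathOf x h i.1 i.2 0) (pathOf x h i.1 i.2 (0 + 1))).Nonempty := by
        rcases lt_or_gt_of_ne h01 with hlt | hlt
        · rw [ed_of_lt hlt]; simp
        · rw [ed_comm, ed_of_lt hlt]; simp
      obtain ⟨e, he⟩ := this
      exact ⟨e, Finset.mem_biUnion.mpr ⟨0, by simp, he⟩⟩
    obtain ⟨s, hsP, hsd, hsm⟩ := exists_max_disj P (Fp x h) hne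
    have hcard : s.card ≤ m := by
      by_contra hc
      obtain ⟨t, hts, htc⟩ := Finset.exists_subset_card_eq (s := s) (n := m) (by omega)
      refine hω x h ⟨t, ?_, htc, ?_, ?_⟩
      · exact fun i hi => (Finset.mem_filter.mp (hsP (hts hi))).1
      · exact hsd.subset (by exact_mod_cast hts)
      · exact fun i hi => (Finset.mem_filter.mp (hsP (hts hi))).2
    let V : Finset (Fin N) := s.biUnion fun i =>
      (Finset.range ((i.1 : ℕ) + 2)).image (pathOf x h i.1 i.2)
    have hV : V.card ≤ m * (R + 1) := by
      calc V.card ≤ s.card * (R + 1) := by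
            refine Finset.card_biUnion_le_card_mul _ _ _ fun i _ => ?_
            refine Finset.card_image_le.trans ?_
            rw [Finset.card_range]
            have := i.1.2
            omega
        _ ≤ _ := Nat.mul_le_mul_right _ hcard
    have hsub : Yset ω (j + 1) x h ⊆
        ((V ∪ V.biUnion fun h' => (Yset ω j x h').toFinset : Finset (Fin N)) : Set (Fin N)) := by
      rintro y ⟨l, γ, hl, hg, hp, rfl⟩
      obtain ⟨i, hi, hil, hieq⟩ := exists_index (R := R) hg (by omega)
      have hFi : Fp x h i = edg l γ := by
        rw [Fp, hil]; exact edg_congr fun t ht => (hieq t ht).symm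
      have hiP : i ∈ P := by
        refine Finset.mem_filter.mpr ⟨hi, fun e he => ?_⟩
        rw [hFi] at he
        obtain ⟨t, ht, het⟩ := Finset.mem_biUnion.mp he
        exact ((Adj_iff ω _ _).mp (hp t (Finset.mem_range.mp ht))).2 e het
      obtain ⟨i', hi', hnd⟩ := hsm i hiP
      obtain ⟨e, he, he'⟩ := Finset.not_disjoint_iff.mp hnd
      rw [hFi] at he
      obtain ⟨t, ht, het⟩ := Finset.mem_biUnion.mp he
      obtain ⟨t', ht', het'⟩ := Finset.mem_biUnion.mp he'
      have htl := Finset.mem_range.mp ht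
      have htl' := Finset.mem_range.mp ht'
      have hmem : ∀ a, a < (i'.1 : ℕ) + 2 → pathOf x h i'.1 i'.2 a ∈ V := fun a ha =>
        Finset.mem_biUnion.mpr ⟨i', hi', Finset.mem_image.mpr ⟨a, by simpa using ha, rfl⟩⟩
      have hVt : γ t ∈ V ∧ γ (t + 1) ∈ V := by
        rcases ed_inter het het' with ⟨ha, hb⟩ | ⟨ha, hb⟩
        · rw [ha, hb]; exact ⟨hmem _ (by omega), hmem _ (by omega)⟩
        · rw [ha, hb]; exact ⟨hmem _ (by omega), hmem _ (by omega)⟩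
      rw [Finset.coe_union]
      rcases Nat.eq_zero_or_pos t with h0 | h0
      · subst h0
        left; exact hVt.2
      · right
        rw [Finset.mem_coe, Finset.mem_biUnion]
        refine ⟨γ t, hVt.1, ?_⟩
        rw [Set.mem_toFinset]
        obtain ⟨h1, h2, h3, h4, h5⟩ := hg
        have hx : x ≠ γ t := by
          rw [← h2]; exact h4 0 t h0 (by omega) (by omega)
        refine ⟨t, γ, by omega, ⟨by omega, h2, rfl, ?_, fun hh => absurd hh hx⟩, ?_, rfl⟩
        · intro a b hab hbt _
          exact h4 a b hab (by omega) (by omega)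
        · exact fun a ha => hp a (by omega)
    calc (Yset ω (j + 1) x h).ncard ≤ _ := Set.ncard_le_ncard hsub (Finset.finite_toSet _)
      _ = _ := Set.ncard_coe_finset _
      _ ≤ V.card + (V.biUnion fun h' => (Yset ω j x h').toFinset).card := Finset.card_union_le _ _
      _ ≤ V.card + V.card * Mrec m R j := by
          gcongr
          refine Finset.card_biUnion_le_card_mul _ _ _ fun h' _ => ?_
          rw [← Set.ncard_eq_toFinset_card']
          exact ih' x h'
      _ = V.card * (1 + Mrec m R j) := by ring
      _ ≤ _ := Nat.mul_le_mul_right _ hV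

theorem S1cyc_card {N : ℕ} (ω : EdgeIdx N → Bool) (m r : ℕ)
    (hω : ∀ x h : Fin N, ω ∉ disjEvent (Ip (2 * r + 1) x h) (Fp x h) m) (x : Fin N) :
    (S1cycA (Adj ω) r x).ncard ≤ Mrec m (2 * r + 1) (2 * r + 1) := by
  refine le_trans ?_ (Yset_card ω m (2 * r + 1) hω (2 * r + 1) le_rfl x x)
  refine Set.ncard_le_ncard ?_ (Set.toFinite _)
  rintro y ⟨_, l, γ, hl, hl', h0, h1, h2, hp, hs⟩
  exact ⟨l, γ, hl', ⟨by omega, h0, h2, hs, fun _ => hl⟩, hp, h1⟩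

theorem S1cyc_symm {N : ℕ} (ω : EdgeIdx N → Bool) (r : ℕ) (x y : Fin N)
    (h : x ∈ S1cycA (Adj ω) r y) : y ∈ S1cycA (Adj ω) r x := by
  obtain ⟨hA, l, γ, hl, hl', h0, h1, h2, hp, hs⟩ := h
  refine ⟨Adj_symm ω hA, l, fun i => if i = 0 then x else γ (l + 1 - i), hl, hl', by simp, ?_, ?_,
    ?_, ?_⟩
  · simp [h2]
  · simp [show l ≠ 0 by omega, h1]
  · intro i hi
    by_cases hi0 : i = 0
    · subst hi0
      simpa [h2] using Adj_symm ω hA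
    · have := hp (l - i) (by omega)
      simp only [hi0, if_false, Nat.succ_ne_zero]
      rw [show l + 1 - (i + 1) = l - i by omega, show l + 1 - i = l - i + 1 by omega]
      exact Adj_symm ω this
  · intro i j hij hjl hne
    by_cases hi0 : i = 0
    · subst hi0
      have hj0 : j ≠ 0 := by omega
      simp only [hj0, if_true, if_false]
      rw [← h1]
      exact hs 1 (l + 1 - j) (by omega) (by omega) (by omega)
    · have hj0 : j ≠ 0 := by omega
      simp only [hi0, hj0, if_false]
      exact (hs (l + 1 - j) (l + 1 - i) (by omega) (by omega) (by omega)).symm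

end GRG

namespace GRG
open Finset

theorem degA_eq_card {N : ℕ} (ω : EdgeIdx N → Bool) (x : Fin N) [DecidablePred (Adj ω x)] :
    degA (Adj ω) x = (Finset.univ.filter (Adj ω x)).card := by
  rw [degA, ← Set.ncard_coe_finset]
  congr 1
  ext y; simp

theorem ed_disj {N : ℕ} (x : Fin N) (s : Set (Fin N)) : s.PairwiseDisjoint (ed x) := by
  intro y _ y' _ hne
  rw [Function.onFun, Finset.disjoint_left]
  intro e he he'
  rcases ed_inter he he' with ⟨_, h⟩ | ⟨h1, h2⟩
  · exact hne h
  · exact hne (h2.trans h1)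

theorem deg_upper_event {N : ℕ} (ω : EdgeIdx N → Bool) (y : Fin N) (a : ℕ)
    (h : a ≤ degA (Adj ω) y) : ω ∈ disjEvent (Finset.univ.erase y) (ed y) a := by
  classical
  rw [degA_eq_card] at h
  obtain ⟨s, hs, hc⟩ := Finset.exists_subset_card_eq h
  have hadj : ∀ u ∈ s, Adj ω y u := fun u hu => (Finset.mem_filter.mp (hs hu)).2
  refine ⟨s, ?_, hc, ed_disj y _, ?_⟩
  · intro u hu
    have := ((Adj_iff ω y u).mp (hadj u hu)).1
    simp [this.symm]
  · exact fun u hu => ((Adj_iff ω y u).mp (hadj u hu)).2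

theorem deg_upper {N : ℕ} {w : Fin N → ℝ} (hw : ∀ x, 0 < w x) (y : Fin N) (a : ℕ) :
    (grgMeasure w).real {ω | a ≤ degA (Adj ω) y} ≤ w y ^ a / a.factorial := by
  have := grg_prob hw
  have hS := sum_w_pos hw y
  refine (measureReal_mono (fun ω h => deg_upper_event ω y a h) (measure_ne_top _ _)).trans ?_
  refine prob_disjEvent hw _ _ _ _ ?_
  calc ∑ u ∈ Finset.univ.erase y, ∏ e ∈ ed y u, pe w e
      ≤ ∑ u ∈ Finset.univ.erase y, w y * w u / ∑ z, w z := by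
        refine Finset.sum_le_sum fun u hu => ?_
        rw [prod_ed w (Finset.ne_of_mem_erase hu).symm]
        exact pGRG_le hw _ _
    _ ≤ ∑ u, w y * w u / ∑ z, w z := by
        refine Finset.sum_le_sum_of_subset_of_nonneg (Finset.subset_univ _) fun u _ _ => ?_
        have := hw y; have := hw u; positivity
    _ = w y := by
        rw [← Finset.sum_div, ← Finset.mul_sum]
        field_simp

/-- Index set of the neighbours / 2-paths towards vertices of large weight. -/
noncomputable def Idu {N : ℕ} (w : Fin N → ℝ) (x : Fin N) (τ : ℝ) :
    Finset (Fin N × Option (Fin N)) :=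
  open Classical in
  Finset.univ.filter (fun i => i.1 ≠ x ∧ ((i.2 = none ∧ τ ≤ w i.1) ∨
    ∃ z, i.2 = some z ∧ z ≠ i.1 ∧ z ≠ x ∧ τ ≤ w z))

def Fdu {N : ℕ} (x : Fin N) (i : Fin N × Option (Fin N)) : Finset (EdgeIdx N) :=
  match i.2 with
  | none => ed x i.1
  | some z => ed x i.1 ∪ ed i.1 z

theorem sum_du {N : ℕ} {w : Fin N → ℝ} (hw : ∀ x, 0 < w x) (x : Fin N) (τ Λ : ℝ) (hτ : 0 < τ)
    (hΛ1 : 1 ≤ Λ) (hΛ : (∑ z, w z ^ 2) / (∑ z, w z) ≤ Λ) :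
    ∑ i ∈ Idu w x τ, ∏ e ∈ Fdu x i, pe w e ≤ 2 * Λ ^ 2 * w x / τ := by
  classical
  set S := ∑ z, w z with hSdef
  have hS : 0 < S := sum_w_pos hw x
  let g : Fin N × Option (Fin N) → ℝ := fun i =>
    match i.2 with
    | none => w x * w i.1 ^ 2 / (S * τ)
    | some z => w x * w i.1 ^ 2 * w z ^ 2 / (S * S * τ)
  have hx := hw x
  have hg : ∀ i, 0 ≤ g i := by
    rintro ⟨y, _ | z⟩ <;> simp only [g] <;> positivity
  have hle : ∀ i ∈ Idu w x τ, ∏ e ∈ Fdu x i, pe w e ≤ g i := by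
    rintro ⟨y, o⟩ hi
    simp only [Idu, Finset.mem_filter, Finset.mem_univ, true_and] at hi
    obtain ⟨hyx, hi⟩ := hi
    have hy := hw y
    rcases hi with ⟨rfl, hty⟩ | ⟨z, rfl, hzy, hzx, htz⟩
    · simp only [Fdu, g]
      rw [prod_ed w hyx.symm]
      refine (pGRG_le hw x y).trans ?_
      rw [← hSdef, div_le_div_iff₀ hS (by positivity)]
      have : w x * w y * S * τ ≤ w x * w y * S * w y := by gcongr
      nlinarith
    · simp only [Fdu, g]
      have hz := hw z
      rw [Finset.prod_union, prod_ed w hyx.symm, prod_ed w hzy.symm]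
      · calc pGRG w x y * pGRG w y z ≤ (w x * w y / S) * (w y * w z / S) :=
              mul_le_mul (pGRG_le hw x y) (pGRG_le hw y z) (pGRG_nonneg hw _ _) (by positivity)
          _ ≤ _ := by
              rw [div_mul_div_comm, div_le_div_iff₀ (by positivity) (by positivity)]
              have : w x * w y ^ 2 * S * S * w z * τ ≤ w x * w y ^ 2 * S * S * w z * w z := by
                gcongr
              nlinarith
      · rw [Finset.disjoint_left]
        intro e he he'
        rcases ed_inter he he' with ⟨h1, _⟩ | ⟨h1, _⟩
        · exact hyx h1.symm
        · exact hzx h1.symm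
  have hQ0 : 0 ≤ (∑ z, w z ^ 2) / S := by positivity
  calc ∑ i ∈ Idu w x τ, ∏ e ∈ Fdu x i, pe w e ≤ ∑ i ∈ Idu w x τ, g i := Finset.sum_le_sum hle
    _ ≤ ∑ i, g i := Finset.sum_le_sum_of_subset_of_nonneg (Finset.subset_univ _) fun i _ _ => hg i
    _ = (w x / τ) * ((∑ z, w z ^ 2) / S + ((∑ z, w z ^ 2) / S) ^ 2) := by
        rw [Fintype.sum_prod_type]
        simp only [Fintype.sum_option, g]
        rw [Finset.sum_add_distrib]
        simp_rw [← Finset.sum_div, ← Finset.mul_sum, ← Finset.sum_mul, ← Finset.mul_sum]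
        field_simp
    _ ≤ (w x / τ) * (Λ + Λ ^ 2) := by gcongr
    _ ≤ (w x / τ) * (2 * Λ ^ 2) := by
        have : 0 ≤ w x / τ := by positivity
        refine mul_le_mul_of_nonneg_left ?_ this
        nlinarith
    _ = _ := by ring

/-- Lower tail of the degree. -/
theorem deg_lower {N : ℕ} {w : Fin N → ℝ} (hw : ∀ x, 0 < w x) (x : Fin N) (a b : ℝ)
    (hb : b ≤ ∑ y ∈ Finset.univ.erase x, pGRG w x y) :
    (grgMeasure w).real {ω | (degA (Adj ω) x : ℝ) ≤ a} ≤ Real.exp (a * Real.log 2 - b / 2) := by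
  classical
  have hprob := grg_prob hw
  have hpb : ∀ e : EdgeIdx N, IsProbabilityMeasure (bern (pGRG w e.val.1 e.val.2)) :=
    fun e => bern_prob (pe_nonneg hw e) (pe_le_one hw e)
  let inc : Finset (EdgeIdx N) := (Finset.univ.erase x).biUnion (ed x)
  let f : EdgeIdx N → Bool → ℝ := fun e c => if e ∈ inc ∧ c = true then 1 / 2 else 1
  let G : (EdgeIdx N → Bool) → ℝ := fun ω => ∏ e, f e (ω e)
  have hG : ∀ ω, G ω = (1 / 2 : ℝ) ^ degA (Adj ω) x := by
    intro ω
    have h1 : G ω = ∏ e ∈ inc, if ω e = true then (1 / 2 : ℝ) else 1 := by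
      simp only [G, f]
      rw [← Finset.prod_subset (Finset.subset_univ inc)]
      · refine Finset.prod_congr rfl fun e he => ?_
        simp [he]
      · intro e _ he; simp [he]
    rw [h1, Finset.prod_biUnion (ed_disj x _), degA_eq_card]
    have h2 : ∀ y ∈ Finset.univ.erase x, (∏ e ∈ ed x y, if ω e = true then (1 / 2 : ℝ) else 1) =
        if Adj ω x y then 1 / 2 else 1 := by
      intro y hy
      have hne := (Finset.ne_of_mem_erase hy).symm
      simp only [Adj_iff]
      rcases lt_or_gt_of_ne hne with h | h
      · rw [ed_of_lt h]; simp [hne]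
      · rw [ed_comm, ed_of_lt h]; simp [hne]
    rw [Finset.prod_congr rfl h2, ← Finset.prod_filter, Finset.prod_const]
    congr 2
    ext y
    simp only [Finset.mem_filter, Finset.mem_erase, Finset.mem_univ, true_and, and_true]
    constructor
    · exact fun h => h.2
    · exact fun h => ⟨((Adj_iff ω x y).mp h).1.symm, h⟩
  have hint1 : ∀ e : EdgeIdx N, ∫ c, f e c ∂(bern (pGRG w e.val.1 e.val.2)) =
      if e ∈ inc then 1 - pe w e / 2 else 1 := by
    intro e
    have h0 : 0 ≤ pGRG w e.val.1 e.val.2 := pe_nonneg hw e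
    have h1 : pGRG w e.val.1 e.val.2 ≤ 1 := pe_le_one hw e
    rw [bern, integral_add_measure (Integrable.of_finite.smul_measure ENNReal.ofReal_ne_top)
        (Integrable.of_finite.smul_measure ENNReal.ofReal_ne_top),
      integral_smul_measure, integral_smul_measure, integral_dirac, integral_dirac,
      ENNReal.toReal_ofReal h0, ENNReal.toReal_ofReal (by linarith)]
    by_cases h : e ∈ inc
    · simp [f, h, pe]; ring
    · simp [f, h]
  have hGint : ∫ ω, G ω ∂(grgMeasure w) ≤ Real.exp (-(b / 2)) := by
    have : ∫ ω, G ω ∂(grgMeasure w) = ∏ e, ∫ c, f e c ∂(bern (pGRG w e.val.1 e.val.2)) := by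
      unfold grgMeasure
      exact integral_fintype_prod_eq_prod (fun e => f e)
    rw [this, Finset.prod_congr rfl fun e _ => hint1 e, Finset.prod_ite_mem, Finset.univ_inter]
    calc ∏ e ∈ inc, (1 - pe w e / 2) ≤ ∏ e ∈ inc, Real.exp (-(pe w e / 2)) := by
          refine Finset.prod_le_prod (fun e _ => ?_) fun e _ => ?_
          · have := pe_le_one hw e; linarith
          · have := Real.add_one_le_exp (-(pe w e / 2)); linarith
      _ = Real.exp (-((∑ e ∈ inc, pe w e) / 2)) := by
          rw [← Real.exp_sum, Finset.sum_neg_distrib, Finset.sum_div]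
      _ ≤ _ := by
          rw [Real.exp_le_exp]
          have : ∑ e ∈ inc, pe w e = ∑ y ∈ Finset.univ.erase x, pGRG w x y := by
            rw [Finset.sum_biUnion (ed_disj x _)]
            refine Finset.sum_congr rfl fun y hy => ?_
            have hne := (Finset.ne_of_mem_erase hy).symm
            rcases lt_or_gt_of_ne hne with h | h
            · rw [ed_of_lt h]; simp [pe]
            · rw [ed_comm, ed_of_lt h]; simp [pe, pGRG_comm]
          rw [this]; linarith
  have hmk := mul_meas_ge_le_integral_of_nonneg (μ := grgMeasure w) (f := G)
    (Filter.Eventually.of_forall fun ω => by simp only [Pi.zero_apply, hG]; positivity)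
    Integrable.of_finite (Real.exp (-(a * Real.log 2)))
  have hsub : {ω : EdgeIdx N → Bool | (degA (Adj ω) x : ℝ) ≤ a} ⊆
      {ω | Real.exp (-(a * Real.log 2)) ≤ G ω} := by
    intro ω hω
    simp only [Set.mem_ofPred_eq] at hω ⊢
    rw [hG, one_div, inv_pow, Real.exp_neg]
    refine inv_anti₀ (by positivity) ?_
    rw [← Real.rpow_natCast, Real.rpow_def_of_pos (by norm_num), Real.exp_le_exp]
    have := Real.log_pos (show (1 : ℝ) < 2 by norm_num)
    nlinarith
  have hm := measureReal_mono (μ := grgMeasure w) hsub (measure_ne_top _ _)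
  have he : 0 < Real.exp (-(a * Real.log 2)) := Real.exp_pos _
  have h1 : Real.exp (-(a * Real.log 2)) *
      (grgMeasure w).real {ω | (degA (Adj ω) x : ℝ) ≤ a} ≤ Real.exp (-(b / 2)) :=
    (mul_le_mul_of_nonneg_left hm he.le).trans (hmk.trans hGint)
  rw [mul_comm, ← le_div_iff₀ he, ← Real.exp_sub] at h1
  rw [show a * Real.log 2 - b / 2 = -(b / 2) - -(a * Real.log 2) by ring]
  exact h1

end GRG

namespace GRG
open Finset Filter

theorem chern {μ : ℝ} (hμ : 0 ≤ μ) {a : ℕ} (ha : 0 < a) :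
    μ ^ a / a.factorial ≤ (Real.exp 1 * μ / a) ^ a := by
  have h := Real.pow_div_factorial_le_exp (x := (a : ℝ)) (by positivity) a
  have ha' : (0 : ℝ) < a := by exact_mod_cast ha
  have hf : (0 : ℝ) < a.factorial := by positivity
  rw [div_pow, mul_pow, ← Real.exp_nat_mul, mul_one, div_le_div_iff₀ hf (by positivity)]
  rw [div_le_iff₀ hf] at h
  calc μ ^ a * (a : ℝ) ^ a ≤ μ ^ a * (Real.exp a * a.factorial) := by gcongr
    _ = _ := by ring

theorem num1 (c η ν K₃ : ℝ) (M : ℕ) (hη : 0 < η) (hc : 0 < c) (hcη : 1 < c * η)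
    (hν : 0 < ν) (hK : 0 < K₃) :
    ∀ᶠ L : ℝ in atTop, ∀ (a : ℕ) (μ : ℝ), c * (ν + 1) * (L / Real.log L) - M ≤ a → 0 ≤ μ →
      μ ≤ K₃ * L ^ (1 - η) → μ ^ a / a.factorial ≤ Real.exp (-(ν + 1) * L) := by
  obtain ⟨c', hc'1, hc'2⟩ : ∃ c', 1 / η < c' ∧ c' < c :=
    exists_between (by rw [div_lt_iff₀ hη]; exact hcη)
  have hc'0 : 0 < c' := lt_trans (by positivity) hc'1
  set η' := 1 / c' with hη'
  have hη'0 : 0 < η' := by positivity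
  have hη'1 : η' < η := by
    rw [hη', div_lt_iff₀ hc'0]
    rw [div_lt_iff₀ hη] at hc'1
    linarith
  have hM : 0 < (c - c') * (ν + 1) / (M + 1) := by
    have : 0 < c - c' := by linarith
    positivity
  have e1 := (isLittleO_log_id_atTop).bound hM
  have e2 := (isLittleO_log_rpow_atTop (r := η - η') (by linarith)).bound
    (c := c' * (ν + 1) / (Real.exp 1 * K₃)) (by positivity)
  filter_upwards [e1, e2, eventually_gt_atTop (Real.exp 1)] with L h1 h2 h3 a μ ha hμ hμ'
  have hL1 : 1 < L := lt_trans (by have := Real.add_one_lt_exp (x := 1) (by norm_num); linarith) h3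
  have hL0 : 0 < L := by linarith
  have hl : 0 < Real.log L := Real.log_pos hL1
  have hLp : 0 < L ^ (η - η') := Real.rpow_pos_of_pos hL0 _
  rw [Real.norm_of_nonneg hl.le, id, Real.norm_of_nonneg hL0.le] at h1
  rw [Real.norm_of_nonneg hl.le, Real.norm_of_nonneg hLp.le] at h2
  have hMle : (M : ℝ) ≤ (c - c') * (ν + 1) * (L / Real.log L) := by
    rw [← mul_div_assoc, le_div_iff₀ hl]
    have h4 : (M : ℝ) * Real.log L ≤ (M + 1) * Real.log L := by
      gcongr; linarith
    refine h4.trans ?_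
    calc (M + 1) * Real.log L ≤ (M + 1) * ((c - c') * (ν + 1) / (M + 1) * L) := by gcongr
      _ = _ := by field_simp
  set a0 := c' * (ν + 1) * (L / Real.log L) with ha0
  have ha0p : 0 < a0 := by positivity
  have haa : a0 ≤ a := by
    have : c * (ν + 1) * (L / Real.log L) = a0 + (c - c') * (ν + 1) * (L / Real.log L) := by
      rw [ha0]; ring
    linarith
  have hap : (0 : ℝ) < a := lt_of_lt_of_le ha0p haa
  have hratio : Real.exp 1 * μ / a ≤ L ^ (-η') := by
    calc Real.exp 1 * μ / a ≤ Real.exp 1 * (K₃ * L ^ (1 - η)) / a0 := by gcongr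
      _ ≤ L ^ (-η') := by
        rw [div_le_iff₀ ha0p, ha0]
        have h5 : Real.exp 1 * K₃ * Real.log L ≤ c' * (ν + 1) * L ^ (η - η') := by
          calc _ ≤ Real.exp 1 * K₃ * (c' * (ν + 1) / (Real.exp 1 * K₃) * L ^ (η - η')) := by gcongr
            _ = _ := by field_simp
        have h6 : L ^ (-η') * L = L ^ (η - η') * L ^ (1 - η) := by
          rw [← Real.rpow_add hL0]
          nth_rewrite 2 [← Real.rpow_one L]
          rw [← Real.rpow_add hL0]
          congr 1; ring
        have h7 : L ^ (-η') * (c' * (ν + 1) * (L / Real.log L)) =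
            c' * (ν + 1) * L ^ (η - η') * L ^ (1 - η) / Real.log L := by
          calc _ = c' * (ν + 1) * (L ^ (-η') * L) / Real.log L := by ring
            _ = _ := by rw [h6]; ring
        rw [h7, le_div_iff₀ hl]
        calc Real.exp 1 * (K₃ * L ^ (1 - η)) * Real.log L
            = (Real.exp 1 * K₃ * Real.log L) * L ^ (1 - η) := by ring
          _ ≤ _ := by gcongr
  calc μ ^ a / a.factorial ≤ (Real.exp 1 * μ / a) ^ a := chern hμ (by exact_mod_cast hap)
    _ ≤ (L ^ (-η')) ^ a := by gcongr
    _ = Real.exp (-(η' * Real.log L) * a) := by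
        rw [← Real.rpow_natCast, ← Real.rpow_mul hL0.le, Real.rpow_def_of_pos hL0]
        congr 1; ring
    _ ≤ Real.exp (-(η' * Real.log L) * a0) := by
        rw [Real.exp_le_exp]
        have : 0 < η' * Real.log L := by positivity
        nlinarith
    _ = _ := by
        congr 1
        rw [ha0, hη']; field_simp

theorem num2 (ε δ C : ℝ) (R : ℕ) (hε : 0 < ε) (hC : 0 < C) :
    ∀ᶠ L : ℝ in atTop, R * (Real.exp (-ε * L) * (C * L ^ δ) ^ R) ≤ Real.exp (-(ε / 2) * L) := by
  have e1 := (isLittleO_rpow_exp_pos_mul_atTop (δ * R) (b := ε / 2) (by positivity)).bound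
    (c := 1 / ((R + 1) * C ^ R)) (by positivity)
  filter_upwards [e1, eventually_gt_atTop 0] with L h1 hL
  have hp : 0 < L ^ (δ * R) := Real.rpow_pos_of_pos hL _
  rw [Real.norm_of_nonneg hp.le, Real.norm_of_nonneg (Real.exp_pos _).le] at h1
  have h2 : (C * L ^ δ) ^ R = C ^ R * L ^ (δ * R) := by
    rw [mul_pow, Real.rpow_mul hL.le, Real.rpow_natCast]
  rw [h2]
  have h3 : Real.exp (-(ε / 2) * L) = Real.exp (-ε * L) * Real.exp (ε / 2 * L) := by
    rw [← Real.exp_add]; congr 1; ring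
  rw [h3]
  have h4 : R * (C ^ R * L ^ (δ * R)) ≤ Real.exp (ε / 2 * L) := by
    calc R * (C ^ R * L ^ (δ * R)) ≤ (R + 1) * (C ^ R * L ^ (δ * R)) := by
          gcongr; linarith
      _ ≤ (R + 1) * (C ^ R * (1 / ((R + 1) * C ^ R) * Real.exp (ε / 2 * L))) := by gcongr
      _ = _ := by field_simp
  calc _ = Real.exp (-ε * L) * (R * (C ^ R * L ^ (δ * R))) := by ring
    _ ≤ _ := by gcongr

theorem det {N : ℕ} (ω : EdgeIdx N → Bool) (r : ℕ) (x : Fin N) (w : Fin N → ℝ) (τ : ℝ)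
    (k M : ℕ) (hcyc : (S1cycA (Adj ω) r x).ncard ≤ M)
    (hbig : ∀ y, degA (Adj ω) x ≤ degA (Adj ω) y → τ ≤ w y)
    (hdu : ω ∉ disjEvent (Idu w x τ) (Fdu x) k) :
    degA (Adj ω) x < degPA (Adj ω) r x + M + k := by
  classical
  let Rm : Set (Fin N) := {y | Adj ω x y ∧ y ∉ S1cycA (Adj ω) r x ∧ ¬ AdjPA (Adj ω) r x y}
  have hsub : {y | Adj ω x y} ⊆ ({y | AdjPA (Adj ω) r x y} ∪ S1cycA (Adj ω) r x) ∪ Rm := by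
    intro y hy
    by_cases h1 : AdjPA (Adj ω) r x y
    · left; left; exact h1
    · by_cases h2 : y ∈ S1cycA (Adj ω) r x
      · left; right; exact h2
      · right; exact ⟨hy, h2, h1⟩
  have hcard : degA (Adj ω) x ≤ degPA (Adj ω) r x + M + Rm.ncard := by
    calc degA (Adj ω) x ≤ _ := Set.ncard_le_ncard hsub (Set.toFinite _)
      _ ≤ _ := Set.ncard_union_le _ _
      _ ≤ ({y | AdjPA (Adj ω) r x y}.ncard + (S1cycA (Adj ω) r x).ncard) + Rm.ncard := by
          gcongr
          exact Set.ncard_union_le _ _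
      _ ≤ _ := by
          unfold degPA
          omega
  suffices hR : Rm.ncard < k by omega
  by_contra hcon
  push Not at hcon
  have hchoice : ∀ y, ∃ o : Option (Fin N), y ∈ Rm → ((o = none ∧ precA (Adj ω) x y) ∨
      ∃ z, o = some z ∧ Adj ω y z ∧ precA (Adj ω) y x ∧ precA (Adj ω) x z) := by
    intro y
    by_cases hy : y ∈ Rm
    · obtain ⟨hA, hnc, hnp⟩ := hy
      have hnc' : x ∉ S1cycA (Adj ω) r y := fun h => hnc (S1cyc_symm ω r x y h)
      by_cases h1 : y ∈ S1duA (Adj ω) r x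
      · obtain ⟨_, _, hyx, z, hyz, _, hxz⟩ := h1
        exact ⟨some z, fun _ => Or.inr ⟨z, rfl, hyz, hyx, hxz⟩⟩
      · by_cases h2 : x ∈ S1duA (Adj ω) r y
        · exact ⟨none, fun _ => Or.inl ⟨rfl, h2.2.2.1⟩⟩
        · exact absurd ⟨⟨hA, hnc, hnc'⟩, h1, h2⟩ hnp
    · exact ⟨none, fun h => absurd h hy⟩
  choose o ho using hchoice
  rw [Set.ncard_eq_toFinset_card'] at hcon
  obtain ⟨t, htR, htc⟩ := Finset.exists_subset_card_eq hcon
  have htR' : ∀ y ∈ t, y ∈ Rm := fun y hy => Set.mem_toFinset.mp (htR hy)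
  refine hdu ⟨t.image (fun y => (y, o y)), ?_, ?_, ?_, ?_⟩
  · intro i hi
    obtain ⟨y, hy, rfl⟩ := Finset.mem_image.mp hi
    have hyR := htR' y hy
    have hyx : y ≠ x := ((Adj_iff ω x y).mp hyR.1).1.symm
    simp only [Idu, Finset.mem_filter, Finset.mem_univ, true_and]
    refine ⟨hyx, ?_⟩
    rcases ho y hyR with ⟨h1, h2⟩ | ⟨z, h1, h2, h3, h4⟩
    · left; exact ⟨h1, hbig y (precA_deg h2)⟩
    · right
      refine ⟨z, h1, ((Adj_iff ω y z).mp h2).1.symm, ?_, hbig z (precA_deg h4)⟩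
      rintro rfl
      exact precA_irrefl _ h4
  · rw [Finset.card_image_of_injective, htc]
    intro a b hab
    exact (Prod.ext_iff.mp hab).1
  · intro i hi i' hi' hne
    obtain ⟨y, hy, rfl⟩ := Finset.mem_image.mp (Finset.mem_coe.mp hi)
    obtain ⟨y', hy', rfl⟩ := Finset.mem_image.mp (Finset.mem_coe.mp hi')
    have hyy : y ≠ y' := by rintro rfl; exact hne rfl
    have hyR := htR' y hy
    have hyR' := htR' y' hy'
    have hyx : y ≠ x := ((Adj_iff ω x y).mp hyR.1).1.symm
    have hyx' : y' ≠ x := ((Adj_iff ω x y').mp hyR'.1).1.symm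
    have d1 : Disjoint (ed x y) (ed x y') := ed_disj x Set.univ (Set.mem_univ y) (Set.mem_univ y') hyy
    have d2 : ∀ a b c : Fin N, b ≠ x → b ≠ a → Disjoint (ed x a) (ed b c) := by
      intro a b c hb hba
      rw [Finset.disjoint_left]
      intro e he he'
      rcases ed_inter he he' with ⟨h1, _⟩ | ⟨_, h1⟩
      · exact hb h1.symm
      · exact hba h1.symm
    rw [Function.onFun]
    rcases ho y hyR with ⟨h1, h2⟩ | ⟨z, h1, h2, h3, h4⟩ <;>
      rcases ho y' hyR' with ⟨h1', h2'⟩ | ⟨z', h1', h2', h3', h4'⟩ <;>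
      simp only [Fdu, h1, h1']
    · exact d1
    · rw [Finset.disjoint_union_right]
      exact ⟨d1, d2 _ _ _ hyx' hyy.symm⟩
    · rw [Finset.disjoint_union_left]
      exact ⟨d1, (d2 _ _ _ hyx hyy).symm⟩
    · rw [Finset.disjoint_union_left, Finset.disjoint_union_right, Finset.disjoint_union_right]
      refine ⟨⟨d1, d2 _ _ _ hyx' hyy.symm⟩, (d2 _ _ _ hyx hyy).symm, ?_⟩
      rw [Finset.disjoint_left]
      intro e he he'
      rcases ed_inter he he' with ⟨h5, _⟩ | ⟨_, h5⟩
      · exact hyy h5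
      · rw [h5] at h4
        exact precA_irrefl _ (precA_trans h3' h4)
  · intro i hi
    obtain ⟨y, hy, rfl⟩ := Finset.mem_image.mp hi
    have hyR := htR' y hy
    have p1 := ((Adj_iff ω x y).mp hyR.1).2
    rcases ho y hyR with ⟨h1, h2⟩ | ⟨z, h1, h2, h3, h4⟩
    · simpa only [Fdu, h1] using p1
    · simp only [Fdu, h1]
      intro e he
      rcases Finset.mem_union.mp he with h | h
      · exact p1 e h
      · exact ((Adj_iff ω y z).mp h2).2 e h

end GRG

namespace GRG
open Filter

theorem union_bound {N : ℕ} {w : Fin N → ℝ} (E : Fin N → Set (EdgeIdx N → Bool)) (q : ℝ)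
    (h : ∀ x, (grgMeasure w).real (E x) ≤ q) :
    (grgMeasure w).real (⋃ x, E x) ≤ N * q := by
  refine (measureReal_iUnion_fintype_le E).trans ?_
  refine (Finset.sum_le_sum fun x _ => h x).trans ?_
  simp

theorem union_bound2 {N : ℕ} {w : Fin N → ℝ} (E : Fin N → Fin N → Set (EdgeIdx N → Bool)) (q : ℝ)
    (h : ∀ x y, (grgMeasure w).real (E x y) ≤ q) :
    (grgMeasure w).real (⋃ x, ⋃ y, E x y) ≤ N * (N * q) :=
  union_bound _ _ fun x => union_bound _ _ (h x)

theorem cond_event {N : ℕ} {w : Fin N → ℝ} (P : Prop) (E : Set (EdgeIdx N → Bool)) (q : ℝ)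
    (hq : 0 ≤ q) (h : P → (grgMeasure w).real E ≤ q) :
    (grgMeasure w).real {ω | P ∧ ω ∈ E} ≤ q := by
  by_cases hP : P
  · have : {ω | P ∧ ω ∈ E} = E := by ext; simp [hP]
    rw [this]; exact h hP
  · have : {ω | P ∧ ω ∈ E} = ∅ := by ext; simp [hP]
    rw [this]; simpa using hq

set_option maxHeartbeats 2000000 in
theorem fixedN {N : ℕ} {w : Fin N → ℝ} (hw : ∀ x, 0 < w x) (r m M : ℕ)
    (L ε ν δ η K C K₃ B Λ : ℝ) (hL : 1 ≤ L) (hN : (N : ℝ) = Real.exp L)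
    (hε : 0 < ε) (hν : 0 < ν) (hη : 0 < η) (hηδ : 2 * δ + η = 1 - η)
    (hK : K = 128 * (ν + 2)) (hK₃ : 1 ≤ K₃) (hK₃' : 2 * K * C ^ 2 ≤ K₃)
    (hΛdef : Λ = C * L ^ δ) (hΛ1 : 1 ≤ Λ) (hΛ : (∑ z, w z ^ 2) / (∑ z, w z) ≤ Λ)
    (hww : ∀ x h, w x * w h / (∑ z, w z) ≤ Real.exp (-ε * L))
    (hlow : ∀ x, w x / 4 ≤ ∑ y ∈ Finset.univ.erase x, pGRG w x y)
    (n1 : ∀ (a : ℕ) (μ : ℝ), B - M ≤ a → 0 ≤ μ →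
      μ ≤ K₃ * L ^ (1 - η) → μ ^ a / a.factorial ≤ Real.exp (-(ν + 1) * L))
    (n2 : ((2 * r + 1 : ℕ) : ℝ) * (Real.exp (-ε * L) * Λ ^ (2 * r + 1)) ≤ Real.exp (-(ε / 2) * L))
    (hm : 2 * (ν + 2) / ε ≤ m) (hM : M = Mrec m (2 * r + 1) (2 * r + 1)) (hMB : (M : ℝ) ≤ B) :
    (grgMeasure w).real {ω | ¬ ∀ x : Fin N,
      (degA (Adj ω) x : ℝ) - (degPA (Adj ω) r x : ℝ) ≤ B} ≤ 5 * Real.exp (-ν * L) := by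
  have hprob := grg_prob hw
  have hL0 : 0 < L := by linarith
  have hK0 : 0 < K := by rw [hK]; positivity
  have hB0 : 0 ≤ B := le_trans (Nat.cast_nonneg _) hMB
  have hLη : 0 < L ^ (-η) := Real.rpow_pos_of_pos hL0 _
  have hLη1 : L ^ (-η) ≤ 1 := Real.rpow_le_one_of_one_le_of_nonpos hL (by linarith)
  have hLL : L * L ^ (-η) = L ^ (1 - η) := by
    rw [sub_eq_add_neg, Real.rpow_add hL0, Real.rpow_one]
  have hfl : B < (⌊B⌋₊ : ℝ) + 1 := Nat.lt_floor_add_one B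
  have hfl' : (⌊B⌋₊ : ℝ) ≤ B := Nat.floor_le hB0
  have hMfl : M ≤ ⌊B⌋₊ := Nat.le_floor hMB
  set τ : Fin N → ℝ := fun x => max (w x / K) L * L ^ (-η) with hτ
  have hτ0 : ∀ x, 0 < τ x := fun x => mul_pos (lt_max_of_lt_right hL0) hLη
  set k := ⌊B⌋₊ - M + 1 with hk
  have hkR : (k : ℝ) = ⌊B⌋₊ - M + 1 := by rw [hk]; push_cast [hMfl]; ring
  set q1 := Real.exp (-(ν + 1) * L) with hq1
  set q2 := Real.exp (-(ν + 2) * L) with hq2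
  let E1 : Fin N → Set (EdgeIdx N → Bool) := fun y =>
    {ω | w y < L ^ (1 - η) ∧ ω ∈ {ω : EdgeIdx N → Bool | ⌊B⌋₊ + 1 ≤ degA (Adj ω) y}}
  let E2 : Fin N → Set (EdgeIdx N → Bool) := fun x =>
    {ω | K * L ≤ w x ∧ ω ∈ {ω : EdgeIdx N → Bool | (degA (Adj ω) x : ℝ) ≤ w x / 16}}
  let E3 : Fin N → Fin N → Set (EdgeIdx N → Bool) := fun x y =>
    {ω | (K * L ≤ w x ∧ w y < τ x) ∧ ω ∈ {ω : EdgeIdx N → Bool | ⌈w x / 16⌉₊ ≤ degA (Adj ω) y}}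
  let E4 : Fin N → Set (EdgeIdx N → Bool) := fun x => disjEvent (Idu w x (τ x)) (Fdu x) k
  let E5 : Fin N → Fin N → Set (EdgeIdx N → Bool) := fun x h =>
    disjEvent (Ip (2 * r + 1) x h) (Fp x h) m
  have b1 : (grgMeasure w).real (⋃ x, E1 x) ≤ N * q1 := by
    refine union_bound _ _ fun y => cond_event _ _ _ (Real.exp_pos _).le fun hy => ?_
    refine (deg_upper hw y _).trans (n1 _ _ ?_ (hw y).le ?_)
    · push_cast
      have : (0 : ℝ) ≤ M := Nat.cast_nonneg _
      linarith
    · have : 0 < L ^ (1 - η) := Real.rpow_pos_of_pos hL0 _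
      nlinarith
  have hwexp : ∀ x, K * L ≤ w x → Real.exp (-(w x / 16)) ≤ q2 := by
    intro x hx
    rw [hq2, Real.exp_le_exp]
    rw [hK] at hx
    nlinarith
  have b2 : (grgMeasure w).real (⋃ x, E2 x) ≤ N * q2 := by
    refine union_bound _ _ fun x => cond_event _ _ _ (Real.exp_pos _).le fun hx => ?_
    refine (deg_lower hw x _ _ (hlow x)).trans (le_trans ?_ (hwexp x hx))
    rw [Real.exp_le_exp]
    have h2 : Real.log 2 < 1 := by have := Real.log_two_lt_d9; linarith
    have := hw x
    nlinarith
  have b3 : (grgMeasure w).real (⋃ x, ⋃ y, E3 x y) ≤ N * (N * q2) := by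
    refine union_bound2 _ _ fun x y => cond_event _ _ _ (Real.exp_pos _).le ?_
    rintro ⟨hx, hy⟩
    have hwx := hw x
    have ha : 0 < ⌈w x / 16⌉₊ := Nat.ceil_pos.mpr (by positivity)
    have ha' : w x / 16 ≤ (⌈w x / 16⌉₊ : ℝ) := Nat.le_ceil _
    refine (deg_upper hw y _).trans ((chern (hw y).le ha).trans (le_trans ?_ (hwexp x hx)))
    have haR : (0 : ℝ) < ⌈w x / 16⌉₊ := by exact_mod_cast ha
    have hyK : w y ≤ w x / K := by
      have h1 : L ≤ w x / K := by rw [le_div_iff₀ hK0]; linarith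
      have h2 : τ x ≤ w x / K := by
        simp only [hτ]
        rw [max_eq_left h1]
        exact mul_le_of_le_one_right (by positivity) hLη1
      linarith
    have hbase : Real.exp 1 * w y / (⌈w x / 16⌉₊ : ℝ) ≤ Real.exp (-1) := by
      rw [div_le_iff₀ haR, Real.exp_neg]
      have he : Real.exp 1 < 2.7182818286 := Real.exp_one_lt_d9
      have he0 : 0 < Real.exp 1 := Real.exp_pos 1
      have hsq : Real.exp 1 * Real.exp 1 ≤ 8 := by nlinarith
      have h3 : Real.exp 1 * Real.exp 1 * w y ≤ ⌈w x / 16⌉₊ := by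
        have h4 : w y * K ≤ w x := by rwa [le_div_iff₀ hK0] at hyK
        have h5 : w y * 256 ≤ w y * K := by
          have := hw y
          rw [hK]; nlinarith
        have := hw y
        nlinarith
      rw [inv_mul_eq_div, le_div_iff₀ he0]
      linarith
    calc (Real.exp 1 * w y / (⌈w x / 16⌉₊ : ℝ)) ^ ⌈w x / 16⌉₊
        ≤ Real.exp (-1) ^ ⌈w x / 16⌉₊ := by
          have := hw y
          gcongr
      _ = Real.exp (-(⌈w x / 16⌉₊ : ℝ)) := by rw [← Real.exp_nat_mul]; congr 1; ring
      _ ≤ _ := by rw [Real.exp_le_exp]; linarith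
  have b4 : (grgMeasure w).real (⋃ x, E4 x) ≤ N * q1 := by
    refine union_bound _ _ fun x => ?_
    have hwx := hw x
    have hnn : 0 ≤ 2 * Λ ^ 2 * w x / τ x := by have := hτ0 x; positivity
    refine (prob_disjEvent hw _ _ _ _ (sum_du hw x (τ x) Λ (hτ0 x) hΛ1 hΛ)).trans
      (n1 _ _ ?_ hnn ?_)
    · rw [hkR]; linarith
    · rw [div_le_iff₀ (hτ0 x)]
      have h1 : w x / K * L ^ (-η) ≤ τ x := by
        simp only [hτ]
        gcongr
        exact le_max_left _ _
      have hp : 0 < L ^ (1 - η) := Real.rpow_pos_of_pos hL0 _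
      have h2 : L ^ (1 - η) * L ^ (-η) = (L ^ δ) ^ 2 := by
        rw [← Real.rpow_add hL0, ← Real.rpow_natCast, ← Real.rpow_mul hL0.le]
        congr 1
        push_cast
        linarith
      calc 2 * Λ ^ 2 * w x = (2 * K * C ^ 2) * ((L ^ δ) ^ 2 * (w x / K)) := by
            rw [hΛdef]; field_simp
        _ ≤ K₃ * ((L ^ δ) ^ 2 * (w x / K)) := by gcongr
        _ = K₃ * L ^ (1 - η) * (w x / K * L ^ (-η)) := by rw [← h2]; ring
        _ ≤ _ := by gcongr
  have b5 : (grgMeasure w).real (⋃ x, ⋃ y, E5 x y) ≤ N * (N * q2) := by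
    refine union_bound2 _ _ fun x h => ?_
    have hb : ∑ i ∈ Ip (2 * r + 1) x h, ∏ e ∈ Fp x h i, pe w e ≤ Real.exp (-(ε / 2) * L) := by
      refine (sum_Fp_le hw x h Λ hΛ1 hΛ).trans (le_trans ?_ n2)
      have := hww x h
      gcongr
    refine (prob_disjEvent hw _ _ _ _ hb).trans ?_
    have h1 : (1 : ℝ) ≤ m.factorial := by exact_mod_cast m.factorial_pos
    refine (div_le_self (by positivity) h1).trans ?_
    rw [← Real.exp_nat_mul, hq2, Real.exp_le_exp]
    rw [div_le_iff₀ hε] at hm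
    nlinarith
  have hsub : {ω | ¬ ∀ x : Fin N, (degA (Adj ω) x : ℝ) - (degPA (Adj ω) r x : ℝ) ≤ B} ⊆
      (⋃ x, E1 x) ∪ (⋃ x, E2 x) ∪ (⋃ x, ⋃ y, E3 x y) ∪ (⋃ x, E4 x) ∪ (⋃ x, ⋃ y, E5 x y) := by
    intro ω hω
    by_contra hbad
    simp only [Set.mem_union, Set.mem_iUnion, not_or, not_exists] at hbad
    obtain ⟨⟨⟨⟨g1, g2⟩, g3⟩, g4⟩, g5⟩ := hbad
    refine hω fun x => ?_
    by_cases hD : (degA (Adj ω) x : ℝ) ≤ B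
    · have : (0 : ℝ) ≤ degPA (Adj ω) r x := Nat.cast_nonneg _
      linarith
    push Not at hD
    have hcyc : (S1cycA (Adj ω) r x).ncard ≤ M := by
      rw [hM]
      exact S1cyc_card ω m r g5 x
    have hbig : ∀ y, degA (Adj ω) x ≤ degA (Adj ω) y → τ x ≤ w y := by
      intro y hxy
      by_contra hy
      push Not at hy
      by_cases hx : K * L ≤ w x
      · have h2 : ¬ ((degA (Adj ω) x : ℝ) ≤ w x / 16) := fun h => g2 x ⟨hx, h⟩
        have h3 : ¬ (⌈w x / 16⌉₊ ≤ degA (Adj ω) y) := fun h => g3 x y ⟨⟨hx, hy⟩, h⟩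
        rw [Nat.ceil_le] at h3
        have : (degA (Adj ω) x : ℝ) ≤ degA (Adj ω) y := by exact_mod_cast hxy
        linarith
      · push Not at hx
        have h1 : w x / K ≤ L := by rw [div_le_iff₀ hK0]; linarith
        have h2 : τ x = L ^ (1 - η) := by
          simp only [hτ]
          rw [max_eq_right h1, hLL]
        have h3 : ¬ (⌊B⌋₊ + 1 ≤ degA (Adj ω) y) := fun h => g1 y ⟨h2 ▸ hy, h⟩
        have h4 : degA (Adj ω) x ≤ ⌊B⌋₊ := by omega
        have h5 : (degA (Adj ω) x : ℝ) ≤ ⌊B⌋₊ := by exact_mod_cast h4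
        linarith
    have hdet := det ω r x w (τ x) k M hcyc hbig (g4 x)
    have h6 : degA (Adj ω) x ≤ degPA (Adj ω) r x + ⌊B⌋₊ := by omega
    have h7 : (degA (Adj ω) x : ℝ) ≤ degPA (Adj ω) r x + ⌊B⌋₊ := by exact_mod_cast h6
    linarith
  have e1 : N * q1 = Real.exp (-ν * L) := by
    rw [hN, hq1, ← Real.exp_add]; congr 1; ring
  have e2 : N * (N * q2) = Real.exp (-ν * L) := by
    rw [hN, hq2, ← Real.exp_add, ← Real.exp_add]; congr 1; ring
  have e3 : N * q2 ≤ Real.exp (-ν * L) := by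
    rw [hN, hq2, ← Real.exp_add, Real.exp_le_exp]; linarith
  refine (measureReal_mono hsub (measure_ne_top _ _)).trans ?_
  have u1 := measureReal_union_le (μ := grgMeasure w) (⋃ x, E1 x) (⋃ x, E2 x)
  have u2 := measureReal_union_le (μ := grgMeasure w) ((⋃ x, E1 x) ∪ (⋃ x, E2 x))
    (⋃ x, ⋃ y, E3 x y)
  have u3 := measureReal_union_le (μ := grgMeasure w)
    ((⋃ x, E1 x) ∪ (⋃ x, E2 x) ∪ (⋃ x, ⋃ y, E3 x y)) (⋃ x, E4 x)
  have u4 := measureReal_union_le (μ := grgMeasure w)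
    ((⋃ x, E1 x) ∪ (⋃ x, E2 x) ∪ (⋃ x, ⋃ y, E3 x y) ∪ (⋃ x, E4 x)) (⋃ x, ⋃ y, E5 x y)
  linarith

/-- Consequences of (A1) and the lower bound on `m1` for a fixed large `N`. -/
theorem weights {N : ℕ} {w : Fin N → ℝ} (hw : ∀ x, 0 < w x) (ε : ℝ) (hε : 0 < ε) (hN : 4 ≤ N)
    (hA1 : ∀ x, w x ≤ (N : ℝ) ^ ((1 : ℝ) / 2 - ε)) (hm1 : (N : ℝ) ^ (-ε) ≤ m1 w) :
    (∀ x h, w x * w h / (∑ z, w z) ≤ (N : ℝ) ^ (-ε)) ∧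
    (∀ x, w x / 4 ≤ ∑ y ∈ Finset.univ.erase x, pGRG w x y) := by
  have hN4 : (4 : ℝ) ≤ N := by exact_mod_cast hN
  have hN0 : (0 : ℝ) < N := by linarith
  have hN1 : (1 : ℝ) ≤ N := by linarith
  have hS : (N : ℝ) ^ (1 - ε) ≤ ∑ z, w z := by
    have h1 : (N : ℝ) * (N : ℝ) ^ (-ε) = (N : ℝ) ^ (1 - ε) := by
      rw [sub_eq_add_neg, Real.rpow_add hN0, Real.rpow_one]
    have h2 : (N : ℝ) * m1 w = ∑ z, w z := by
      unfold m1; field_simp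
    rw [← h1, ← h2]
    gcongr
  have hSp : 0 < (N : ℝ) ^ (1 - ε) := Real.rpow_pos_of_pos hN0 _
  have hS0 : 0 < ∑ z, w z := by linarith
  have hprod : ∀ x h, w x * w h ≤ (N : ℝ) ^ (-ε) * ∑ z, w z := by
    intro x h
    calc w x * w h ≤ (N : ℝ) ^ ((1 : ℝ) / 2 - ε) * (N : ℝ) ^ ((1 : ℝ) / 2 - ε) := by
          have := hw x; have := hw h
          exact mul_le_mul (hA1 x) (hA1 h) (hw h).le (by positivity)
      _ = (N : ℝ) ^ (-ε) * (N : ℝ) ^ (1 - ε) := by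
          rw [← Real.rpow_add hN0, ← Real.rpow_add hN0]; congr 1; ring
      _ ≤ _ := by gcongr
  refine ⟨fun x h => ?_, fun x => ?_⟩
  · rw [div_le_iff₀ hS0]; exact hprod x h
  · have hx := hw x
    have hNe : (N : ℝ) ^ (-ε) ≤ 1 := Real.rpow_le_one_of_one_le_of_nonpos hN1 (by linarith)
    have h1 : ∀ y, w x * w y / (2 * ∑ z, w z) ≤ pGRG w x y := by
      intro y
      have hy := hw y
      unfold pGRG
      have := hprod x y
      refine div_le_div_of_nonneg_left (by positivity) (by positivity) ?_
      nlinarith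
    have h2 : w x ≤ (∑ z, w z) / 2 := by
      have h3 : (2 : ℝ) ≤ (N : ℝ) ^ ((1 : ℝ) / 2) := by
        rw [← Real.sqrt_eq_rpow]
        exact Real.le_sqrt_of_sq_le (by linarith)
      have h4 : (N : ℝ) ^ ((1 : ℝ) / 2 - ε) * (N : ℝ) ^ ((1 : ℝ) / 2) = (N : ℝ) ^ (1 - ε) := by
        rw [← Real.rpow_add hN0]; congr 1; ring
      have h5 := hA1 x
      have h6 : 0 < (N : ℝ) ^ ((1 : ℝ) / 2 - ε) := Real.rpow_pos_of_pos hN0 _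
      nlinarith
    calc w x / 4 ≤ w x * ((∑ z, w z) - w x) / (2 * ∑ z, w z) := by
          rw [div_le_div_iff₀ (by norm_num) (by positivity)]
          nlinarith
      _ = ∑ y ∈ Finset.univ.erase x, w x * w y / (2 * ∑ z, w z) := by
          rw [← Finset.sum_div, ← Finset.mul_sum]
          congr 2
          rw [← Finset.add_sum_erase _ _ (Finset.mem_univ x)]; ring
      _ ≤ _ := Finset.sum_le_sum fun y _ => h1 y

theorem eventual_bound
    (ε δ : ℝ) (hε : 0 < ε) (hδ : 0 < δ) (hδ' : δ < 1 / 3) (r : ℕ)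
    (w : (N : ℕ) → Fin N → ℝ) (hpos : ∀ N x, 0 < w N x)
    (hA1 : ∀ N x, w N x ≤ (N : ℝ) ^ ((1 : ℝ) / 2 - ε))
    (hA2m1 : ∀ N : ℕ, 1 ≤ N → (N : ℝ) ^ (-ε) ≤ m1 (w N))
    (hA2m2 : ∃ C > 0, ∀ N : ℕ, 2 ≤ N → m2 (w N) / m1 (w N) ≤ C * Real.log N ^ δ)
    (ν : ℝ) (hν : 0 < ν) :
    ∀ᶠ N : ℕ in atTop, (grgMeasure (w N)).real {ω | ¬ ∀ x : Fin N,
      (degA (Adj ω) x : ℝ) - (degPA (Adj ω) r x : ℝ) ≤ xi ν δ N / 2} ≤ 5 * (N : ℝ) ^ (-ν) := by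
  obtain ⟨C, hC, hm2⟩ := hA2m2
  have hd1 : 0 < 1 - δ := by linarith
  have hd2 : 0 < 1 - 2 * δ := by linarith
  set η := (1 - 2 * δ) / 2 with hη
  set c := 3 / 2 * (2 - 3 * δ) / ((1 - δ) * (1 - 2 * δ)) with hc
  have hη0 : 0 < η := by positivity
  have hc0 : 0 < c := by
    have : 0 < 2 - 3 * δ := by linarith
    positivity
  have hcη : 1 < c * η := by
    have : c * η = 3 / 4 * (2 - 3 * δ) / (1 - δ) := by
      rw [hc, hη]; field_simp; ring
    rw [this, lt_div_iff₀ hd1]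
    linarith
  set m := ⌈2 * (ν + 2) / ε⌉₊ with hm
  set M := Mrec m (2 * r + 1) (2 * r + 1) with hM
  set C' := max C 1 with hC'
  have hC'1 : 1 ≤ C' := le_max_right _ _
  set K := 128 * (ν + 2) with hK
  have hK0 : 0 < K := by positivity
  set K₃ := 2 * K * C' ^ 2 + 1 with hK₃
  have hK₃1 : 1 ≤ K₃ := by rw [hK₃]; have : 0 ≤ 2 * K * C' ^ 2 := by positivity
                           linarith
  have ev1 := num1 c η ν K₃ M hη0 hc0 hcη hν (by linarith)
  have ev2 := num2 ε δ C' (2 * r + 1) hε (by linarith)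
  have ev3 : ∀ᶠ L : ℝ in atTop, (M : ℝ) ≤ c * (ν + 1) * (L / Real.log L) := by
    have h := Real.isLittleO_log_id_atTop.bound
      (c := c * (ν + 1) / (M + 1)) (by positivity)
    filter_upwards [h, eventually_gt_atTop 1] with L h hL
    have hl : 0 < Real.log L := Real.log_pos hL
    rw [Real.norm_of_nonneg hl.le, id, Real.norm_of_nonneg (by linarith)] at h
    rw [← mul_div_assoc, le_div_iff₀ hl]
    rw [div_mul_eq_mul_div, le_div_iff₀ (by positivity)] at h
    nlinarith
  have hT : Tendsto (fun N : ℕ => Real.log N) atTop atTop :=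
    Real.tendsto_log_atTop.comp tendsto_natCast_atTop_atTop
  filter_upwards [hT.eventually ev1, hT.eventually ev2, hT.eventually ev3,
    hT.eventually (eventually_ge_atTop 1), eventually_ge_atTop 4] with N n1 n2 n3 hL hN
  have hN0 : (0 : ℝ) < N := by
    have : (4 : ℝ) ≤ N := by exact_mod_cast hN
    linarith
  have hxi : xi ν δ N / 2 = c * (ν + 1) * (Real.log N / Real.log (Real.log N)) := by
    unfold xi; rw [hc]; ring
  obtain ⟨w1, w2⟩ := weights (hpos N) ε hε hN (hA1 N) (hA2m1 N (by omega))
  have hLδ : 1 ≤ Real.log N ^ δ := Real.one_le_rpow hL hδ.le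
  have hΛ1 : 1 ≤ C' * Real.log N ^ δ := by nlinarith
  have hΛ : (∑ z, w N z ^ 2) / (∑ z, w N z) ≤ C' * Real.log N ^ δ := by
    have h1 : m2 (w N) / m1 (w N) = (∑ z, w N z ^ 2) / (∑ z, w N z) := by
      have hS : ∑ z, w N z ≠ 0 := (sum_w_pos (hpos N) ⟨0, by omega⟩).ne'
      unfold m1 m2; field_simp
    rw [← h1]
    refine (hm2 N (by omega)).trans ?_
    have : C ≤ C' := le_max_left _ _
    gcongr
  have hexp : ∀ s : ℝ, (N : ℝ) ^ s = Real.exp (s * Real.log N) := by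
    intro s; rw [Real.rpow_def_of_pos hN0, mul_comm]
  rw [hxi, hexp]
  refine fixedN (hpos N) r m M (Real.log N) ε ν δ η K C' K₃ _ (C' * Real.log N ^ δ) hL
    (Real.exp_log hN0).symm hε hν hη0 (by rw [hη]; ring) hK hK₃1 (by rw [hK₃]; linarith) rfl hΛ1 hΛ
    (fun x h => by rw [← hexp]; exact w1 x h) w2 n1 n2 (Nat.le_ceil _) hM n3

theorem part1
    (ε δ : ℝ) (hε : 0 < ε) (hδ : 0 < δ) (hδ' : δ < 1 / 3) (r : ℕ)
    (w : (N : ℕ) → Fin N → ℝ) (hpos : ∀ N x, 0 < w N x)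
    (hA1 : ∀ N x, w N x ≤ (N : ℝ) ^ ((1 : ℝ) / 2 - ε))
    (hA2m1 : ∀ N : ℕ, 1 ≤ N → (N : ℝ) ^ (-ε) ≤ m1 (w N))
    (hA2m2 : ∃ C > 0, ∀ N : ℕ, 2 ≤ N → m2 (w N) / m1 (w N) ≤ C * Real.log N ^ δ)
    (ν : ℝ) (hν : 0 < ν) :
    ∃ C > (0 : ℝ), ∀ N : ℕ,
      1 - ENNReal.ofReal (C * (N : ℝ) ^ (-ν)) ≤
        grgMeasure (w N) {ω | ∀ x : Fin N,
          (deg ω x : ℝ) - (degPA (Adj ω) r x : ℝ) ≤ xi ν δ N / 2} := by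
  obtain ⟨N0, hN0⟩ := eventually_atTop.mp
    (eventual_bound ε δ hε hδ hδ' r w hpos hA1 hA2m1 hA2m2 ν hν)
  refine ⟨5 + (N0 : ℝ) ^ ν, by positivity, fun N => ?_⟩
  have hprob := grg_prob (hpos N)
  by_cases hN : N0 ≤ N
  · have hb := hN0 N hN
    set good : Set (EdgeIdx N → Bool) := {ω | ∀ x : Fin N,
          (deg ω x : ℝ) - (degPA (Adj ω) r x : ℝ) ≤ xi ν δ N / 2} with hgood
    have hcompl : {ω | ¬ ∀ x : Fin N,
      (degA (Adj ω) x : ℝ) - (degPA (Adj ω) r x : ℝ) ≤ xi ν δ N / 2} = goodᶜ := rfl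
    rw [hcompl] at hb
    rw [tsub_le_iff_right]
    have h1 : grgMeasure (w N) goodᶜ ≤ ENNReal.ofReal ((5 + (N0 : ℝ) ^ ν) * (N : ℝ) ^ (-ν)) := by
      rw [← ofReal_measureReal (measure_ne_top _ _)]
      refine ENNReal.ofReal_le_ofReal (hb.trans ?_)
      have h2 : 0 ≤ (N0 : ℝ) ^ ν := by positivity
      gcongr
      linarith
    calc (1 : ENNReal) = grgMeasure (w N) (good ∪ goodᶜ) := by
          rw [Set.union_compl_self, measure_univ]
      _ ≤ grgMeasure (w N) good + grgMeasure (w N) goodᶜ := measure_union_le _ _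
      _ ≤ _ := by gcongr
  · push Not at hN
    rcases Nat.eq_zero_or_pos N with h0 | h0
    · subst h0
      have : {ω : EdgeIdx 0 → Bool | ∀ x : Fin 0,
          (deg ω x : ℝ) - (degPA (Adj ω) r x : ℝ) ≤ xi ν δ 0 / 2} = Set.univ := by
        ext ω; simp
      rw [this, measure_univ]
      exact tsub_le_self
    · have hNp : (0 : ℝ) < N := by exact_mod_cast h0
      have h1 : (1 : ℝ) ≤ (5 + (N0 : ℝ) ^ ν) * (N : ℝ) ^ (-ν) := by
        have h2 : (N : ℝ) ^ ν ≤ (N0 : ℝ) ^ ν :=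
          Real.rpow_le_rpow hNp.le (by exact_mod_cast hN.le) hν.le
        have h3 : (N : ℝ) ^ ν * (N : ℝ) ^ (-ν) = 1 := by
          rw [← Real.rpow_add hNp]; simp
        have h4 : 0 < (N : ℝ) ^ (-ν) := Real.rpow_pos_of_pos hNp _
        nlinarith
      have h5 : (1 : ENNReal) ≤ ENNReal.ofReal ((5 + (N0 : ℝ) ^ ν) * (N : ℝ) ^ (-ν)) := by
        rw [← ENNReal.ofReal_one]; exact ENNReal.ofReal_le_ofReal h1
      rw [tsub_eq_zero_of_le h5]
      exact zero_le

end GRG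

open GRG in
/-- Properties of the pruned graph.
Under (A1) and (A2), for every `ν > 0`: (1) with `ν`-high probability, for all `x`,
`D_x − D_x^p ≤ ξ_ν/2`; (2) `G^p` contains no down-up paths; (3) `G^p` is a forest. -/
theorem pruned_graph_properties
    (ε δ : ℝ) (hε : 0 < ε) (hε' : ε < 1 / 2) (hδ : 0 < δ) (hδ' : δ < 1 / 3)
    (r : ℕ) (hr : 6 ≤ r)
    (w : (N : ℕ) → Fin N → ℝ)
    (hpos : ∀ N x, 0 < w N x)
    (hA1 : ∀ N x, w N x ≤ (N : ℝ) ^ ((1 : ℝ) / 2 - ε))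
    (hA2m1 : ∀ N : ℕ, 1 ≤ N → (N : ℝ) ^ (-ε) ≤ m1 (w N))
    (hA2m2 : ∃ C > 0, ∀ N : ℕ, 2 ≤ N → m2 (w N) / m1 (w N) ≤ C * Real.log N ^ δ)
    (ν : ℝ) (hν : 0 < ν) :
    (∃ C > (0 : ℝ), ∀ N : ℕ,
      1 - ENNReal.ofReal (C * (N : ℝ) ^ (-ν)) ≤
        grgMeasure (w N) {ω | ∀ x : Fin N,
          (deg ω x : ℝ) - (degPA (Adj ω) r x : ℝ) ≤ xi ν δ N / 2}) ∧
    (∀ (N : ℕ) (ω : EdgeIdx N → Bool),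
      ¬∃ x y z : Fin N, AdjPA (Adj ω) r x y ∧ AdjPA (Adj ω) r y z ∧
        precA (Adj ω) y x ∧ precA (Adj ω) x z) ∧
    (∀ (N : ℕ) (ω : EdgeIdx N → Bool),
      ¬∃ (l : ℕ) (γ : ℕ → Fin N), 3 ≤ l ∧ γ 0 = γ l ∧
        IsPathOn (AdjPA (Adj ω) r) l γ ∧ IsSimplePath l γ) := by
  exact ⟨part1 ε δ hε hδ hδ' r w hpos hA1 hA2m1 hA2m2 ν hν, fun N ω => no_down_up r N ω,
    fun N ω => is_forest r N ω⟩
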